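/- Let n ≥ 1, 1 ≤ p < ∞, let i ≥ 0 be an integer, let α satisfy 2i < α < 2i+2, and let (φ,ψ) be a parabolic Littlewood–Paley family on ℝ^{n+1}. There exist constants c, C > 0 (depending only on n, p, α, i, φ, ψ) such that for every Schwartz function f on ℝ^{n+1}: c·N_{α,p}(f)^p ≤ Σ_{|β|+2l ≤ 2i} ‖D_X^β D_t^l f‖_{Lᵖ(ℝ^{n+1})}^p + ∫_{ℝⁿ}∫_ℝ∫_ℝ |D_t^i f(X,t) − D_t^i f(X,s)|^p/|t−s|^{1+p(α−2i)/2} dt ds dX + Σ_{|β|=2i} ∫_ℝ∫_{ℝⁿ}∫_{ℝⁿ} |D_X^β f(X+Y,t) − 2D_X^β f(X,t) + D_X^β f(X−Y,t)|^p/|Y|^{n+p(α−2i)} dY dX dt ≤ C·N_{α,p}(f)^p. -/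

import Mathlib

noncomputable section

open MeasureTheory Real Complex
open scoped ENNReal NNReal Real BigOperators

/-- Euclidean space `ℝⁿ`. -/
abbrev Rn (n : ℕ) : Type := EuclideanSpace ℝ (Fin n)

/-- The space `ℝ^{n+1} = ℝⁿ × ℝ`, points written `(X, t)`. -/
abbrev Rn1 (n : ℕ) : Type := EuclideanSpace ℝ (Fin n) × ℝ

/-- Fourier transform on `ℝ^{n+1}`:
`𝓕f(ξ,τ) = ∫ e^{−2πi(X·ξ + tτ)} f(X,t) dX dt`. -/
def FT1 {n : ℕ} (f : Rn1 n → ℂ) (q : Rn1 n) : ℂ :=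
  ∫ p : Rn1 n,
    Complex.exp (-(2 * (π : ℂ) * Complex.I) *
      (((∑ k, p.1 k * q.1 k) + p.2 * q.2 : ℝ) : ℂ)) * f p

/-- Inverse Fourier transform on `ℝ^{n+1}`. -/
def IFT1 {n : ℕ} (f : Rn1 n → ℂ) (x : Rn1 n) : ℂ :=
  ∫ q : Rn1 n,
    Complex.exp ((2 * (π : ℂ) * Complex.I) *
      (((∑ k, q.1 k * x.1 k) + q.2 * x.2 : ℝ) : ℂ)) * f q

/-- The Fourier multiplier operator `f ↦ 𝓕⁻¹(m · 𝓕 f)` on `ℝ^{n+1}`. -/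
def MOp {n : ℕ} (m : Rn1 n → ℂ) (f : Rn1 n → ℂ) : Rn1 n → ℂ :=
  IFT1 (fun q => m q * FT1 f q)

/-- The symbol `m_α(ξ,τ) = (1 + 4π²|ξ|² + iτ)^{α/2}` (principal branch). -/
def mSym {n : ℕ} (α : ℝ) (q : Rn1 n) : ℂ :=
  (1 + 4 * (π : ℂ) ^ 2 * (‖q.1‖ : ℂ) ^ 2 + Complex.I * (q.2 : ℂ)) ^ ((α : ℂ) / 2)

/-- Partial derivative `∂_{X_k}`. -/
def dX {n : ℕ} (k : Fin n) (f : Rn1 n → ℂ) : Rn1 n → ℂ :=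
  fun x => fderiv ℝ f x (EuclideanSpace.single k 1, 0)

/-- Partial derivative `∂_t`. -/
def dT {n : ℕ} (f : Rn1 n → ℂ) : Rn1 n → ℂ :=
  fun x => fderiv ℝ f x (0, 1)

/-- Iterated spatial derivative `D_X^β` for a multi-index `β`. -/
def dXmulti {n : ℕ} (β : Fin n → ℕ) (f : Rn1 n → ℂ) : Rn1 n → ℂ :=
  (List.finRange n).foldr (fun k g => (dX k)^[β k] g) f

/-- The half time-derivative `D_t^{1/2} f = 𝓕⁻¹(|τ|^{1/2}·𝓕f)`. -/
def halfDt {n : ℕ} (f : Rn1 n → ℂ) : Rn1 n → ℂ :=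
  MOp (fun q => ((|q.2| ^ ((1 : ℝ) / 2) : ℝ) : ℂ)) f

/-- The `Lᵖ(ℝ^{n+1})` norm (as a value in `ℝ≥0∞`), `p` a real exponent. -/
def pNorm {n : ℕ} (p : ℝ) (f : Rn1 n → ℂ) : ℝ≥0∞ :=
  eLpNorm f (ENNReal.ofReal p) volume

/-- Multi-indices `β ∈ ℕⁿ` with `|β| = N`. -/
def multiIdx (n N : ℕ) : Finset (Fin n → ℕ) :=
  (Fintype.piFinset fun _ : Fin n => Finset.range (N + 1)).filter fun β => (∑ k, β k) = N

/-- Convolution on `ℝ^{n+1}`. -/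
def conv1 {n : ℕ} (g f : Rn1 n → ℂ) : Rn1 n → ℂ :=
  fun x => ∫ y : Rn1 n, g (x - y) * f y

/-- A parabolic Littlewood–Paley family on `ℝ^{n+1}`. -/
structure ParabolicLP (n : ℕ) where
  φ : SchwartzMap (Rn1 n) ℂ
  ψ : SchwartzMap (Rn1 n) ℂ
  ft_pos : ∀ q : Rn1 n,
    1 / 2 < ‖q.1‖ + |q.2| ^ ((1 : ℝ) / 2) → ‖q.1‖ + |q.2| ^ ((1 : ℝ) / 2) < 2 →
      0 < (FT1 (⇑φ) q).re ∧ (FT1 (⇑φ) q).im = 0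
  ft_supp : ∀ q : Rn1 n,
    ¬(1 / 2 < ‖q.1‖ + |q.2| ^ ((1 : ℝ) / 2) ∧ ‖q.1‖ + |q.2| ^ ((1 : ℝ) / 2) < 2) →
      FT1 (⇑φ) q = 0
  ft_sum : ∀ q : Rn1 n, q ≠ 0 →
    ∑' i : ℤ, FT1 (⇑φ) (((2 : ℝ) ^ (-i)) • q.1, ((2 : ℝ) ^ (-(2 * i))) * q.2) = 1
  ft_psi : ∀ q : Rn1 n,
    FT1 (⇑ψ) q =
      1 - ∑' i : ℕ,
        FT1 (⇑φ) (((2 : ℝ) ^ (-((i : ℤ) + 1))) • q.1, ((2 : ℝ) ^ (-(2 * ((i : ℤ) + 1)))) * q.2)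

/-- The dilate `φ_i`, whose Fourier transform is `𝓕φ(2^{−i}ξ, 2^{−2i}τ)`. -/
def lpPhi {n : ℕ} (P : ParabolicLP n) (i : ℕ) : Rn1 n → ℂ :=
  fun x => (((2 : ℝ) ^ (i * (n + 2)) : ℝ) : ℂ) *
    P.φ (((2 : ℝ) ^ i) • x.1, ((2 : ℝ) ^ (2 * i)) * x.2)

/-- Parabolic Besov norm `N_{s,p}(f)` on `ℝ^{n+1}`, `1 ≤ p < ∞`. -/
def pBesov {n : ℕ} (P : ParabolicLP n) (s p : ℝ) (f : Rn1 n → ℂ) : ℝ≥0∞ :=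
  eLpNorm (conv1 (⇑P.ψ) f) (ENNReal.ofReal p) volume +
  (∑' i : ℕ,
    (ENNReal.ofReal ((2 : ℝ) ^ (s * ((i : ℝ) + 1))) *
      eLpNorm (conv1 (lpPhi P (i + 1)) f) (ENNReal.ofReal p) volume) ^ p) ^ (1 / p)

/-- Parabolic Besov norm `N_{s,∞}(f)` on `ℝ^{n+1}`. -/
def pBesovInf {n : ℕ} (P : ParabolicLP n) (s : ℝ) (f : Rn1 n → ℂ) : ℝ≥0∞ :=
  max (eLpNorm (conv1 (⇑P.ψ) f) ⊤ volume)
    (⨆ i : ℕ, ENNReal.ofReal ((2 : ℝ) ^ (s * ((i : ℝ) + 1))) *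
      eLpNorm (conv1 (lpPhi P (i + 1)) f) ⊤ volume)

/-- The time interval `(0, T)` for `0 < T ≤ ∞`. -/
def tSet (T : ℝ≥0∞) : Set ℝ := {t : ℝ | 0 < t ∧ ENNReal.ofReal t < T}

/-- Lebesgue measure restricted to the strip `ℝⁿ × (0,T)`. -/
def stripMeasure (n : ℕ) (T : ℝ≥0∞) : Measure (Rn1 n) :=
  volume.restrict {x : Rn1 n | x.2 ∈ tSet T}

/-- The parabolic Sobolev norm `‖g‖_{W^{2i,i}_p(ℝⁿ_T)}`. -/
def wNorm {n : ℕ} (i : ℕ) (p : ℝ) (T : ℝ≥0∞) (g : Rn1 n → ℂ) : ℝ≥0∞ :=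
  ∑ l ∈ Finset.range (i + 1),
    ∑ β ∈ (Fintype.piFinset fun _ : Fin n => Finset.range (2 * i + 1)).filter
        (fun β => (∑ k, β k) + 2 * l ≤ 2 * i),
      eLpNorm (dXmulti β (dT^[l] g)) (ENNReal.ofReal p) (stripMeasure n T)

/-- Time-regularity seminorm `[g]_{t,β,p,T}`. -/
def semT {n : ℕ} (b p : ℝ) (T : ℝ≥0∞) (g : Rn1 n → ℂ) : ℝ≥0∞ :=
  (∫⁻ X : Rn n, ∫⁻ t in tSet T, ∫⁻ s in tSet T,
      ENNReal.ofReal (‖g (X, t) - g (X, s)‖ ^ p / |t - s| ^ (1 + p * b / 2))) ^ (1 / p)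

/-- Space-regularity seminorm `[g]_{x,β,p,T}`. -/
def semX {n : ℕ} (b p : ℝ) (T : ℝ≥0∞) (g : Rn1 n → ℂ) : ℝ≥0∞ :=
  (∫⁻ t in tSet T, ∫⁻ X : Rn n, ∫⁻ Y : Rn n,
      ENNReal.ofReal (‖g (X + Y, t) - 2 * g (X, t) + g (X - Y, t)‖ ^ p /
        ‖Y‖ ^ ((n : ℝ) + p * b))) ^ (1 / p)

/-- The parabolic Besov norm `‖g‖_{B^{α,α/2}_p(ℝⁿ_T)}`, formed with index `i` where
`2i < α < 2i+2`. -/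
def pbNorm {n : ℕ} (i : ℕ) (α p : ℝ) (T : ℝ≥0∞) (g : Rn1 n → ℂ) : ℝ≥0∞ :=
  wNorm i p T g +
  ∑ l ∈ Finset.range (i + 1),
    ∑ β ∈ (Fintype.piFinset fun _ : Fin n => Finset.range (2 * i + 1)).filter
        (fun β => (∑ k, β k) + 2 * l = 2 * i),
      (semT (α - 2 * i) p T (dXmulti β (dT^[l] g)) +
        semX (α - 2 * i) p T (dXmulti β (dT^[l] g)))

/-- Fourier transform on `ℝⁿ`. -/
def FTn {n : ℕ} (f : Rn n → ℂ) (ξ : Rn n) : ℂ :=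
  ∫ x : Rn n, Complex.exp (-(2 * (π : ℂ) * Complex.I) * (((∑ k, x k * ξ k : ℝ)) : ℂ)) * f x

/-- Inverse Fourier transform on `ℝⁿ`. -/
def IFTn {n : ℕ} (f : Rn n → ℂ) (x : Rn n) : ℂ :=
  ∫ ξ : Rn n, Complex.exp ((2 * (π : ℂ) * Complex.I) * (((∑ k, ξ k * x k : ℝ)) : ℂ)) * f ξ

/-- Convolution on `ℝⁿ`. -/
def convn {n : ℕ} (g f : Rn n → ℂ) : Rn n → ℂ := fun x => ∫ y : Rn n, g (x - y) * f y

/-- A Littlewood–Paley family on `ℝⁿ`. -/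
structure LPFamily (n : ℕ) where
  φ : SchwartzMap (Rn n) ℂ
  ψ : SchwartzMap (Rn n) ℂ
  ft_pos : ∀ ξ : Rn n, 1 / 2 < ‖ξ‖ → ‖ξ‖ < 2 →
    0 < (FTn (⇑φ) ξ).re ∧ (FTn (⇑φ) ξ).im = 0
  ft_supp : ∀ ξ : Rn n, ¬(1 / 2 < ‖ξ‖ ∧ ‖ξ‖ < 2) → FTn (⇑φ) ξ = 0
  ft_sum : ∀ ξ : Rn n, ξ ≠ 0 → ∑' i : ℤ, FTn (⇑φ) (((2 : ℝ) ^ (-i)) • ξ) = 1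
  ft_psi : ∀ ξ : Rn n,
    FTn (⇑ψ) ξ = 1 - ∑' i : ℕ, FTn (⇑φ) (((2 : ℝ) ^ (-((i : ℤ) + 1))) • ξ)

/-- The dilate `φ′_i(x) = 2^{in} φ′(2^i x)`. -/
def lpPhin {n : ℕ} (P : LPFamily n) (i : ℕ) : Rn n → ℂ :=
  fun x => (((2 : ℝ) ^ (i * n) : ℝ) : ℂ) * P.φ (((2 : ℝ) ^ i) • x)

/-- Besov norm `B_{s,p}(f)` on `ℝⁿ`, `1 ≤ p < ∞`. -/
def besovN {n : ℕ} (P : LPFamily n) (s p : ℝ) (f : Rn n → ℂ) : ℝ≥0∞ :=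
  eLpNorm (convn (⇑P.ψ) f) (ENNReal.ofReal p) volume +
  (∑' i : ℕ,
    (ENNReal.ofReal ((2 : ℝ) ^ (s * ((i : ℝ) + 1))) *
      eLpNorm (convn (lpPhin P (i + 1)) f) (ENNReal.ofReal p) volume) ^ p) ^ (1 / p)

/-- The heat kernel `Γ(X,t)` on `ℝⁿ` (zero for `t ≤ 0`). -/
def heatKer (n : ℕ) (X : Rn n) (t : ℝ) : ℝ :=
  if 0 < t then (4 * π * t) ^ (-(n : ℝ) / 2) * Real.exp (-‖X‖ ^ 2 / (4 * t)) else 0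

/-- The heat extension `u(X,t) = ∫ Γ(X−Y,t) f(Y) dY`. -/
def heatExt {n : ℕ} (f : Rn n → ℂ) : Rn1 n → ℂ :=
  fun x => ∫ Y : Rn n, (heatKer n (x.1 - Y) x.2 : ℂ) * f Y

section

open scoped SchwartzMap FourierTransform LineDeriv ContDiff

variable {n : ℕ}

/-! ### Fourier analysis of Schwartz functions on `ℝⁿ × ℝ` -/

/-- Transport of Schwartz functions from `ℝⁿ × ℝ` to the Euclidean product. -/
def toL2 (n : ℕ) : 𝓢(Rn1 n, ℂ) →L[ℂ] 𝓢(WithLp 2 (Rn n × ℝ), ℂ) :=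
  SchwartzMap.compCLMOfContinuousLinearEquiv ℂ (WithLp.prodContinuousLinearEquiv 2 ℝ (Rn n) ℝ)

/-- Transport of Schwartz functions from the Euclidean product to `ℝⁿ × ℝ`. -/
def ofL2 (n : ℕ) : 𝓢(WithLp 2 (Rn n × ℝ), ℂ) →L[ℂ] 𝓢(Rn1 n, ℂ) :=
  SchwartzMap.compCLMOfContinuousLinearEquiv ℂ
    (WithLp.prodContinuousLinearEquiv 2 ℝ (Rn n) ℝ).symm

lemma toL2_apply (f : 𝓢(Rn1 n, ℂ)) (x : WithLp 2 (Rn n × ℝ)) : toL2 n f x = f x.ofLp := rfl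

lemma ofL2_apply (f : 𝓢(WithLp 2 (Rn n × ℝ), ℂ)) (x : Rn1 n) :
    ofL2 n f x = f (WithLp.toLp 2 x) := rfl

lemma toL2_ofL2 (f : 𝓢(WithLp 2 (Rn n × ℝ), ℂ)) : toL2 n (ofL2 n f) = f := by
  ext x; simp [toL2_apply, ofL2_apply]

lemma ofL2_toL2 (f : 𝓢(Rn1 n, ℂ)) : ofL2 n (toL2 n f) = f := by
  ext x; simp [toL2_apply, ofL2_apply]

/-- The Fourier transform `FT1` as an operator on Schwartz functions. -/
def fs (f : 𝓢(Rn1 n, ℂ)) : 𝓢(Rn1 n, ℂ) := ofL2 n (𝓕 (toL2 n f))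

/-- The inverse Fourier transform `IFT1` as an operator on Schwartz functions. -/
def fsi (f : 𝓢(Rn1 n, ℂ)) : 𝓢(Rn1 n, ℂ) := ofL2 n (𝓕⁻ (toL2 n f))

lemma fs_fsi (f : 𝓢(Rn1 n, ℂ)) : fs (fsi f) = f := by
  simp [fs, fsi, toL2_ofL2, ofL2_toL2]

lemma fsi_fs (f : 𝓢(Rn1 n, ℂ)) : fsi (fs f) = f := by
  simp [fs, fsi, toL2_ofL2, ofL2_toL2]

lemma fs_injective {f g : 𝓢(Rn1 n, ℂ)} (h : ∀ q, fs f q = fs g q) : f = g := by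
  rw [← fsi_fs f, ← fsi_fs g]
  congr 1
  ext q
  exact h q

lemma inner_l2 (x : WithLp 2 (Rn n × ℝ)) (q : WithLp 2 (Rn n × ℝ)) :
    inner ℝ x q = (∑ k, x.ofLp.1 k * q.ofLp.1 k) + x.ofLp.2 * q.ofLp.2 := by
  simp [WithLp.prod_inner_apply, PiLp.inner_apply, mul_comm]

lemma fs_apply (f : 𝓢(Rn1 n, ℂ)) (q : Rn1 n) : fs f q = FT1 (⇑f) q := by
  rw [fs, ofL2_apply, SchwartzMap.fourier_coe, Real.fourier_eq', FT1]
  rw [← (WithLp.volume_preserving_ofLp (Rn n) ℝ).integral_comp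
    (MeasurableEquiv.toLp 2 (Rn n × ℝ)).symm.measurableEmbedding]
  refine integral_congr_ae (.of_forall fun x => ?_)
  simp only [inner_l2, toL2_apply, smul_eq_mul]
  congr 2
  push_cast
  ring

lemma fsi_apply (f : 𝓢(Rn1 n, ℂ)) (x : Rn1 n) : fsi f x = IFT1 (⇑f) x := by
  rw [fsi, ofL2_apply, SchwartzMap.fourierInv_coe, Real.fourierInv_eq', IFT1]
  rw [← (WithLp.volume_preserving_ofLp (Rn n) ℝ).integral_comp
    (MeasurableEquiv.toLp 2 (Rn n × ℝ)).symm.measurableEmbedding]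
  refine integral_congr_ae (.of_forall fun x => ?_)
  simp only [inner_l2, toL2_apply, smul_eq_mul]
  congr 2
  push_cast
  ring

lemma fs_add (f g : 𝓢(Rn1 n, ℂ)) : fs (f + g) = fs f + fs g := by
  simp [fs, FourierTransform.fourier_add]

lemma fs_smul (c : ℂ) (f : 𝓢(Rn1 n, ℂ)) : fs (c • f) = c • fs f := by
  simp [fs, FourierTransform.fourier_smul]

lemma fs_sum {ι : Type*} (s : Finset ι) (f : ι → 𝓢(Rn1 n, ℂ)) :
    fs (∑ j ∈ s, f j) = ∑ j ∈ s, fs (f j) := by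
  classical
  induction s using Finset.induction_on with
  | empty => simpa using fs_smul (0 : ℂ) (0 : 𝓢(Rn1 n, ℂ))
  | insert a s ha ih => rw [Finset.sum_insert ha, Finset.sum_insert ha, fs_add, ih]

/-- Convolution of Schwartz functions on `ℝⁿ × ℝ`. -/
def cv (f g : 𝓢(Rn1 n, ℂ)) : 𝓢(Rn1 n, ℂ) :=
  ofL2 n (SchwartzMap.convolution (ContinuousLinearMap.mul ℂ ℂ) (toL2 n f) (toL2 n g))

lemma fs_cv (f g : 𝓢(Rn1 n, ℂ)) (q : Rn1 n) : fs (cv f g) q = fs f q * fs g q := by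
  simp [fs, cv, toL2_ofL2, SchwartzMap.fourier_convolution, ofL2_apply,
    SchwartzMap.pairing_apply_apply]

lemma cv_apply (f g : 𝓢(Rn1 n, ℂ)) (x : Rn1 n) : cv f g x = conv1 (⇑f) (⇑g) x := by
  rw [cv, ofL2_apply, SchwartzMap.convolution_apply, ← convolution_flip, convolution, conv1]
  rw [← (WithLp.volume_preserving_ofLp (Rn n) ℝ).integral_comp
    (MeasurableEquiv.toLp 2 (Rn n × ℝ)).symm.measurableEmbedding]
  refine integral_congr_ae (.of_forall fun y => ?_)
  simp [toL2_apply, mul_comm]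

lemma coe_cv (f g : 𝓢(Rn1 n, ℂ)) : ⇑(cv f g) = conv1 (⇑f) (⇑g) := funext (cv_apply f g)

lemma lineDeriv_toL2 (m : Rn1 n) (f : 𝓢(Rn1 n, ℂ)) :
    toL2 n (∂_{m} f) = ∂_{WithLp.toLp 2 m} (toL2 n f) := by
  rw [toL2, SchwartzMap.lineDerivOp_compCLMOfContinuousLinearEquiv]
  rfl

lemma fs_lineDeriv (m : Rn1 n) (f : 𝓢(Rn1 n, ℂ)) (q : Rn1 n) :
    fs (∂_{m} f) q =
      2 * π * Complex.I * (((∑ k, q.1 k * m.1 k) + q.2 * m.2 : ℝ) : ℂ) * fs f q := by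
  have : (fun x : WithLp 2 (Rn n × ℝ) => inner ℝ x (WithLp.toLp 2 m)).HasTemperateGrowth :=
    ((innerSL ℝ).flip (WithLp.toLp 2 m)).hasTemperateGrowth
  rw [fs, lineDeriv_toL2, SchwartzMap.fourier_lineDerivOp_eq, ofL2_apply, smul_apply,
    SchwartzMap.smulLeftCLM_apply_apply this, inner_l2, fs, ofL2_apply]
  simp [mul_assoc]

/-- The partial derivative `∂_{X_k}` on Schwartz functions. -/
def sdX (k : Fin n) (f : 𝓢(Rn1 n, ℂ)) : 𝓢(Rn1 n, ℂ) :=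
  ∂_{((EuclideanSpace.single k 1, 0) : Rn1 n)} f

/-- The partial derivative `∂_t` on Schwartz functions. -/
def sdT (f : 𝓢(Rn1 n, ℂ)) : 𝓢(Rn1 n, ℂ) := ∂_{((0, 1) : Rn1 n)} f

lemma coe_sdX (k : Fin n) (f : 𝓢(Rn1 n, ℂ)) : ⇑(sdX k f) = dX k ⇑f := rfl

lemma coe_sdT (f : 𝓢(Rn1 n, ℂ)) : ⇑(sdT f) = dT ⇑f := rfl

lemma fs_sdX (k : Fin n) (f : 𝓢(Rn1 n, ℂ)) (q : Rn1 n) :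
    fs (sdX k f) q = 2 * π * Complex.I * (q.1 k : ℂ) * fs f q := by
  simp [sdX, fs_lineDeriv]

lemma fs_sdT (f : 𝓢(Rn1 n, ℂ)) (q : Rn1 n) :
    fs (sdT f) q = 2 * π * Complex.I * (q.2 : ℂ) * fs f q := by
  simp [sdT, fs_lineDeriv]

/-- The derivative `D_X^β D_t^l` on Schwartz functions. -/
def sD (β : Fin n → ℕ) (l : ℕ) (f : 𝓢(Rn1 n, ℂ)) : 𝓢(Rn1 n, ℂ) :=
  (List.finRange n).foldr (fun k g => (sdX k)^[β k] g) (sdT^[l] f)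

lemma coe_iterate_sdT (l : ℕ) (f : 𝓢(Rn1 n, ℂ)) : ⇑(sdT^[l] f) = dT^[l] ⇑f := by
  induction l with
  | zero => rfl
  | succ l ih => rw [Function.iterate_succ_apply', Function.iterate_succ_apply', coe_sdT, ih]

lemma coe_iterate_sdX (k : Fin n) (l : ℕ) (f : 𝓢(Rn1 n, ℂ)) :
    ⇑((sdX k)^[l] f) = (dX k)^[l] ⇑f := by
  induction l with
  | zero => rfl
  | succ l ih => rw [Function.iterate_succ_apply', Function.iterate_succ_apply', coe_sdX, ih]

lemma coe_sD (β : Fin n → ℕ) (l : ℕ) (f : 𝓢(Rn1 n, ℂ)) :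
    ⇑(sD β l f) = dXmulti β (dT^[l] ⇑f) := by
  rw [sD, dXmulti, ← coe_iterate_sdT]
  generalize sdT^[l] f = g
  induction List.finRange n with
  | nil => rfl
  | cons k L ih => simp only [List.foldr_cons, coe_iterate_sdX, ih]

lemma fs_iterate_sdT (l : ℕ) (f : 𝓢(Rn1 n, ℂ)) (q : Rn1 n) :
    fs (sdT^[l] f) q = (2 * π * Complex.I * (q.2 : ℂ)) ^ l * fs f q := by
  induction l with
  | zero => simp
  | succ l ih => rw [Function.iterate_succ_apply', fs_sdT, ih]; ring

lemma fs_iterate_sdX (k : Fin n) (l : ℕ) (f : 𝓢(Rn1 n, ℂ)) (q : Rn1 n) :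
    fs ((sdX k)^[l] f) q = (2 * π * Complex.I * (q.1 k : ℂ)) ^ l * fs f q := by
  induction l with
  | zero => simp
  | succ l ih => rw [Function.iterate_succ_apply', fs_sdX, ih]; ring

/-- The symbol of `D_X^β D_t^l`. -/
def dsym (β : Fin n → ℕ) (l : ℕ) (q : Rn1 n) : ℂ :=
  (∏ k, (2 * π * Complex.I * (q.1 k : ℂ)) ^ β k) * (2 * π * Complex.I * (q.2 : ℂ)) ^ l

lemma fs_sD (β : Fin n → ℕ) (l : ℕ) (f : 𝓢(Rn1 n, ℂ)) (q : Rn1 n) :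
    fs (sD β l f) q = dsym β l q * fs f q := by
  have h : ∀ (L : List (Fin n)) (g : 𝓢(Rn1 n, ℂ)),
      fs (L.foldr (fun k g => (sdX k)^[β k] g) g) q =
        (L.map fun k => (2 * π * Complex.I * (q.1 k : ℂ)) ^ β k).prod * fs g q := by
    intro L g
    induction L with
    | nil => simp
    | cons k L ih => simp only [List.foldr_cons, fs_iterate_sdX, ih, List.map_cons,
        List.prod_cons, mul_assoc]
  rw [sD, h, fs_iterate_sdT, dsym, ← mul_assoc, Fin.prod_univ_def]

/-- Parabolic scaling `(X, t) ↦ (aX, a²t)`. -/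
def dsc (a : ℝ) (x : Rn1 n) : Rn1 n := (a • x.1, a ^ 2 * x.2)

lemma dsc_dsc (a b : ℝ) (x : Rn1 n) : dsc a (dsc b x) = dsc (a * b) x := by
  ext <;> simp [dsc] <;> ring

lemma dsc_one (x : Rn1 n) : dsc 1 x = x := by
  ext <;> simp [dsc]

lemma dsym_dsc (β : Fin n → ℕ) (l : ℕ) (a : ℝ) (q : Rn1 n) :
    dsym β l (dsc a q) = (a : ℂ) ^ ((∑ k, β k) + 2 * l) * dsym β l q := by
  have h : ∀ k, (2 * π * Complex.I * ((dsc a q).1 k : ℂ)) ^ β k =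
      (a : ℂ) ^ β k * (2 * π * Complex.I * (q.1 k : ℂ)) ^ β k := by
    intro k
    rw [← mul_pow]; congr 1; simp [dsc]; ring
  have h2 : (2 * π * Complex.I * ((dsc a q).2 : ℂ)) ^ l =
      (a : ℂ) ^ (2 * l) * (2 * π * Complex.I * (q.2 : ℂ)) ^ l := by
    rw [pow_mul, ← mul_pow]; congr 1; simp [dsc]; ring
  simp only [dsym, h, h2, Finset.prod_mul_distrib, Finset.prod_pow_eq_pow_sum]
  ring

/-- Parabolic scaling as a continuous linear equivalence. -/
def dscEquiv (n : ℕ) {a : ℝ} (ha : a ≠ 0) : Rn1 n ≃L[ℝ] Rn1 n :=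
  (ContinuousLinearEquiv.smulLeft (Units.mk0 a ha)).prodCongr
    (ContinuousLinearEquiv.smulLeft (Units.mk0 (a ^ 2) (pow_ne_zero 2 ha)))

lemma dscEquiv_apply {a : ℝ} (ha : a ≠ 0) (x : Rn1 n) : dscEquiv n ha x = dsc a x := by
  ext <;> simp [dscEquiv, dsc, Units.smul_def]

lemma measurable_dsc (a : ℝ) : Measurable (dsc a : Rn1 n → Rn1 n) := by
  unfold dsc; fun_prop

lemma map_dsc {a : ℝ} (ha : 0 < a) :
    Measure.map (dsc a) (volume : Measure (Rn1 n)) = ENNReal.ofReal ((a ^ (n + 2))⁻¹) • volume := by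
  have h1 : Measure.map (a • · : Rn n → Rn n) volume = ENNReal.ofReal ((a ^ n)⁻¹) • volume := by
    rw [Measure.map_addHaar_smul volume ha.ne', abs_of_pos (by simp; positivity)]
    simp
  have h2 : Measure.map (a ^ 2 * · : ℝ → ℝ) volume = ENNReal.ofReal ((a ^ 2)⁻¹) • volume := by
    rw [Real.map_volume_mul_left (by positivity), abs_of_pos (by positivity)]
  have : (dsc a : Rn1 n → Rn1 n) = Prod.map (a • ·) (a ^ 2 * ·) := rfl
  rw [this, Measure.volume_eq_prod, ← Measure.map_prod_map _ _ (by fun_prop) (by fun_prop), h1, h2,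
    Measure.prod_smul_left, Measure.prod_smul_right, smul_smul, ← ENNReal.ofReal_mul (by positivity),
    pow_add, mul_inv]

lemma lintegral_dsc {a : ℝ} (ha : 0 < a) (F : Rn1 n → ℝ≥0∞) (hF : Measurable F) :
    ∫⁻ x, ENNReal.ofReal (a ^ (n + 2)) * F (dsc a x) = ∫⁻ x, F x := by
  rw [lintegral_const_mul (f := fun x => F (dsc a x)) _ (hF.comp (measurable_dsc a)),
    ← lintegral_map hF (measurable_dsc a), map_dsc ha, lintegral_smul_measure, smul_eq_mul, ← mul_assoc,
    ← ENNReal.ofReal_mul (by positivity), mul_inv_cancel₀ (by positivity)]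
  simp

lemma integral_dsc {a : ℝ} (ha : 0 < a) (F : Rn1 n → ℂ) :
    ∫ x, ((a ^ (n + 2) : ℝ) : ℂ) * F (dsc a x) = ∫ x, F x := by
  have he : MeasurableEmbedding (dsc a : Rn1 n → Rn1 n) := by
    have := (dscEquiv n ha.ne').toHomeomorph.measurableEmbedding
    convert! this using 1
  rw [integral_const_mul, ← he.integral_map, map_dsc ha, integral_smul_measure,
    ENNReal.toReal_ofReal (by positivity), Complex.real_smul, ← mul_assoc, ← Complex.ofReal_mul,
    mul_inv_cancel₀ (by positivity)]
  simp

/-- The `L¹`-normalised parabolic dilate `a^{n+2} f(aX, a²t)`. -/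
def dil (a : ℝ) (ha : a ≠ 0) (f : 𝓢(Rn1 n, ℂ)) : 𝓢(Rn1 n, ℂ) :=
  ((a ^ (n + 2) : ℝ) : ℂ) • SchwartzMap.compCLMOfContinuousLinearEquiv ℂ (dscEquiv n ha) f

lemma dil_apply {a : ℝ} (ha : a ≠ 0) (f : 𝓢(Rn1 n, ℂ)) (x : Rn1 n) :
    dil a ha f x = ((a ^ (n + 2) : ℝ) : ℂ) * f (dsc a x) := by
  rw [← dscEquiv_apply ha]; rfl

lemma fs_dil {a : ℝ} (ha : 0 < a) (f : 𝓢(Rn1 n, ℂ)) (q : Rn1 n) :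
    fs (dil a ha.ne' f) q = fs f (dsc a⁻¹ q) := by
  rw [fs_apply, fs_apply, FT1, FT1, ← integral_dsc ha (fun x => _ * f x)]
  refine integral_congr_ae (.of_forall fun x => ?_)
  simp only [dil_apply]
  have : (∑ k, (dsc a x).1 k * (dsc a⁻¹ q).1 k) + (dsc a x).2 * (dsc a⁻¹ q).2 =
      (∑ k, x.1 k * q.1 k) + x.2 * q.2 := by
    simp only [dsc, PiLp.smul_apply, smul_eq_mul]
    congr 1
    · refine Finset.sum_congr rfl fun k _ => ?_
      field_simp
    · field_simp
  rw [this]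
  ring

lemma lintegral_dil {a : ℝ} (ha : 0 < a) (f : 𝓢(Rn1 n, ℂ)) :
    ∫⁻ x, ‖dil a ha.ne' f x‖ₑ = ∫⁻ x, ‖f x‖ₑ := by
  rw [← lintegral_dsc ha _ f.continuous.measurable.enorm]
  refine lintegral_congr fun x => ?_
  rw [dil_apply, enorm_mul, ← ofReal_norm, Complex.norm_real, Real.norm_of_nonneg (by positivity)]

lemma sD_dil (β : Fin n → ℕ) (l : ℕ) {a : ℝ} (ha : 0 < a) (f : 𝓢(Rn1 n, ℂ)) :
    sD β l (dil a ha.ne' f) = (a : ℂ) ^ ((∑ k, β k) + 2 * l) • dil a ha.ne' (sD β l f) := by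
  refine fs_injective fun q => ?_
  rw [fs_sD, fs_dil ha, fs_smul, smul_apply, fs_dil ha, fs_sD, dsym_dsc]
  rw [smul_eq_mul, ← mul_assoc, ← mul_assoc, ← mul_pow]
  simp [ha.ne']

/-- Translation `f(· + v)` on Schwartz functions. -/
def sh (v : Rn1 n) (f : 𝓢(Rn1 n, ℂ)) : 𝓢(Rn1 n, ℂ) := SchwartzMap.compSubConstCLM ℂ (-v) f

lemma sh_apply (v : Rn1 n) (f : 𝓢(Rn1 n, ℂ)) (x : Rn1 n) : sh v f x = f (x + v) := by
  simp [sh]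

/-! ### Littlewood–Paley blocks -/

/-- The parabolic homogeneous length `|ξ| + |τ|^{1/2}`. -/
def rho (q : Rn1 n) : ℝ := ‖q.1‖ + |q.2| ^ ((1 : ℝ) / 2)

lemma rho_dsc {a : ℝ} (ha : 0 ≤ a) (q : Rn1 n) : rho (dsc a q) = a * rho q := by
  have : (a ^ 2) ^ ((1 : ℝ) / 2) = a := by rw [← Real.sqrt_eq_rpow, Real.sqrt_sq ha]
  simp only [rho, dsc, norm_smul, abs_mul, Real.norm_eq_abs, abs_of_nonneg ha,
    abs_of_nonneg (pow_nonneg ha 2)]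
  rw [Real.mul_rpow (by positivity) (by positivity), this]
  ring

lemma continuous_rho : Continuous (rho : Rn1 n → ℝ) := by
  unfold rho
  refine (continuous_fst.norm).add ?_
  exact (continuous_snd.abs).rpow_const fun _ => Or.inr (by norm_num)

lemma two_zpow_dsc (i : ℤ) (q : Rn1 n) :
    (((2 : ℝ) ^ (-i)) • q.1, ((2 : ℝ) ^ (-(2 * i))) * q.2) = dsc ((2 : ℝ) ^ (-i)) q := by
  rw [dsc, ← zpow_natCast, ← zpow_mul]
  congr 3
  push_cast
  ring

namespace ParabolicLP

variable (P : ParabolicLP n)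

lemma fs_phi_eq_zero {q : Rn1 n} (h : rho q ≤ 1 / 2 ∨ 2 ≤ rho q) : fs P.φ q = 0 := by
  rw [fs_apply]
  refine P.ft_supp q fun h' => ?_
  have h1 : 1 / 2 < rho q := h'.1
  have h2 : rho q < 2 := h'.2
  rcases h with h | h <;> linarith

lemma fs_psi (q : Rn1 n) :
    fs P.ψ q = 1 - ∑' i : ℕ, fs P.φ (dsc ((2 : ℝ) ^ (-((i : ℤ) + 1))) q) := by
  rw [fs_apply, P.ft_psi]
  congr 1
  refine tsum_congr fun i => ?_
  rw [fs_apply, ← two_zpow_dsc]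

lemma fs_sum {q : Rn1 n} (hq : q ≠ 0) :
    ∑' i : ℤ, fs P.φ (dsc ((2 : ℝ) ^ (-i)) q) = 1 := by
  rw [← P.ft_sum q hq]
  refine tsum_congr fun i => ?_
  rw [fs_apply, ← two_zpow_dsc]

lemma fs_psi_of_le {q : Rn1 n} (h : rho q ≤ 1) : fs P.ψ q = 1 := by
  rw [fs_psi, tsum_congr (g := fun _ => 0), tsum_zero, sub_zero]
  intro i
  refine P.fs_phi_eq_zero (Or.inl ?_)
  rw [rho_dsc (by positivity)]
  have : (2 : ℝ) ^ (-((i : ℤ) + 1)) ≤ 2 ^ (-1 : ℤ) :=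
    zpow_le_zpow_right₀ (by norm_num) (by omega)
  have h0 : 0 ≤ rho q := by unfold rho; positivity
  calc _ ≤ (2 : ℝ) ^ (-1 : ℤ) * 1 := by gcongr
    _ = 1 / 2 := by norm_num

lemma fs_psi_of_ge {q : Rn1 n} (h : 2 ≤ rho q) : fs P.ψ q = 0 := by
  have hq : q ≠ 0 := by
    rintro rfl
    norm_num [rho] at h
  rw [fs_psi, sub_eq_zero, ← P.fs_sum hq]
  have hinj : Function.Injective (fun i : ℕ => (i : ℤ) + 1) := fun a b hab => by
    simpa using hab
  rw [← hinj.tsum_eq (f := fun i : ℤ => fs P.φ (dsc ((2 : ℝ) ^ (-i)) q))]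
  intro i hi
  by_contra hi'
  refine hi (P.fs_phi_eq_zero (Or.inr ?_))
  have hi0 : i ≤ 0 := by
    by_contra! hc
    exact hi' ⟨(i - 1).toNat, by simp; omega⟩
  rw [rho_dsc (by positivity)]
  have : (1 : ℝ) ≤ 2 ^ (-i) := one_le_zpow₀ (by norm_num) (by omega)
  nlinarith

lemma fs_psi_half (q : Rn1 n) :
    fs P.ψ (dsc 2⁻¹ q) = fs P.ψ q + fs P.φ (dsc 2⁻¹ q) := by
  have hs : Summable fun i : ℕ => fs P.φ (dsc ((2 : ℝ) ^ (-((i : ℤ) + 1))) q) := by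
    obtain ⟨N, hN⟩ := pow_unbounded_of_one_lt (2 * rho q) (one_lt_two)
    refine summable_of_ne_finset_zero (s := Finset.range N) fun i hi => ?_
    refine P.fs_phi_eq_zero (Or.inl ?_)
    have hi' : N ≤ i := by simpa using hi
    rw [rho_dsc (by positivity), zpow_neg, inv_mul_le_iff₀ (by positivity)]
    have : (2 : ℝ) ^ N ≤ 2 ^ ((i : ℤ) + 1) := by
      rw [← zpow_natCast]; exact zpow_le_zpow_right₀ (by norm_num) (by omega)
    linarith
  rw [fs_psi, fs_psi, hs.tsum_eq_zero_add]
  simp only [dsc_dsc]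
  have : ∀ i : ℕ, (2 : ℝ) ^ (-((i : ℤ) + 1)) * 2⁻¹ = 2 ^ (-(((i + 1 : ℕ) : ℤ) + 1)) := by
    intro i
    rw [← zpow_neg_one, ← zpow_add₀ (by norm_num)]
    congr 1
  simp only [this]
  norm_num
  ring

/-- The Littlewood–Paley blocks `ψ, φ₁, φ₂, …` as Schwartz functions. -/
def blk : ℕ → 𝓢(Rn1 n, ℂ)
  | 0 => P.ψ
  | j + 1 => dil (2 ^ (j + 1)) (by positivity) P.φ

lemma coe_blk_succ (j : ℕ) : ⇑(P.blk (j + 1)) = lpPhi P (j + 1) := by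
  ext x
  rw [blk, dil_apply, lpPhi, ← pow_mul, dsc, ← pow_mul]
  ring_nf

/-- The dilate `2^{J(n+2)} ψ(2^J ·)`. -/
def psiDil (J : ℕ) : 𝓢(Rn1 n, ℂ) := dil (2 ^ J) (by positivity) P.ψ

lemma fs_psiDil (J : ℕ) (q : Rn1 n) : fs (P.psiDil J) q = fs P.ψ (dsc ((2 ^ J)⁻¹) q) :=
  fs_dil (by positivity) _ _

lemma fs_blk_succ (j : ℕ) (q : Rn1 n) :
    fs (P.blk (j + 1)) q = fs P.φ (dsc ((2 ^ (j + 1))⁻¹) q) :=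
  fs_dil (by positivity) _ _

lemma sum_blk (J : ℕ) : ∑ j ∈ Finset.range (J + 1), P.blk j = P.psiDil J := by
  refine fs_injective fun q => ?_
  rw [_root_.fs_sum, sum_apply]
  induction J with
  | zero => simp [fs_psiDil, dsc_one, blk]
  | succ J ih =>
    rw [Finset.sum_range_succ, ih, fs_psiDil, fs_psiDil, fs_blk_succ]
    have : ((2 : ℝ) ^ (J + 1))⁻¹ = 2⁻¹ * (2 ^ J)⁻¹ := by rw [pow_succ]; simp [mul_comm]
    rw [this, ← dsc_dsc, fs_psi_half]

/-- A fattened kernel reproducing every block. -/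
def fat : 𝓢(Rn1 n, ℂ) := dil 2 (by positivity) P.ψ

lemma cv_fat_blk (j : ℕ) : cv (dil (2 ^ j) (by positivity) P.fat) (P.blk j) = P.blk j := by
  refine fs_injective fun q => ?_
  rw [fs_cv, fs_dil (by positivity), fat, fs_dil (by positivity)]
  by_cases h : rho (dsc ((2 ^ j)⁻¹) q) ≤ 2
  · rw [P.fs_psi_of_le, one_mul]
    rw [rho_dsc (by positivity)]
    linarith
  · push Not at h
    have : fs (P.blk j) q = 0 := by
      cases j with
      | zero => exact P.fs_psi_of_ge (by simpa [dsc_one] using h.le)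
      | succ j => rw [fs_blk_succ]; exact P.fs_phi_eq_zero (Or.inr h.le)
    rw [this, mul_zero]

lemma integral_psi : ∫ x, P.ψ x = 1 := by
  have h := P.fs_psi_of_le (q := 0) (by norm_num [rho])
  rw [fs_apply, FT1] at h
  simpa using h

end ParabolicLP

lemma cv_comm (f g : 𝓢(Rn1 n, ℂ)) : cv f g = cv g f :=
  fs_injective fun q => by rw [fs_cv, fs_cv, mul_comm]

lemma cv_smul (c : ℂ) (f g : 𝓢(Rn1 n, ℂ)) : cv (c • f) g = c • cv f g :=
  fs_injective fun q => by simp only [fs_cv, fs_smul, smul_apply, smul_eq_mul, mul_assoc]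

lemma cv_sum {ι : Type*} (s : Finset ι) (f : ι → 𝓢(Rn1 n, ℂ)) (g : 𝓢(Rn1 n, ℂ)) :
    cv (∑ j ∈ s, f j) g = ∑ j ∈ s, cv (f j) g :=
  fs_injective fun q => by simp only [fs_cv, fs_sum, sum_apply, Finset.sum_mul]

lemma cv_sh (v : Rn1 n) (f g : 𝓢(Rn1 n, ℂ)) : cv (sh v f) g = sh v (cv f g) := by
  ext x
  rw [cv_apply, sh_apply, cv_apply, conv1, conv1]
  refine integral_congr_ae (.of_forall fun y => ?_)
  simp only [sh_apply]
  rw [sub_add_eq_add_sub]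

lemma ParabolicLP.cv_blk_sD (P : ParabolicLP n) (β : Fin n → ℕ) (l j : ℕ) (f : 𝓢(Rn1 n, ℂ)) :
    cv (P.blk j) (sD β l f) = ((2 ^ j : ℝ) : ℂ) ^ ((∑ k, β k) + 2 * l) •
      cv (dil (2 ^ j) (by positivity) (sD β l P.fat)) (cv (P.blk j) f) := by
  rw [← cv_smul, ← sD_dil β l (a := 2 ^ j) (by positivity)]
  refine fs_injective fun q => ?_
  have h := congrArg (fun g => fs g q) (P.cv_fat_blk j)
  simp only [fs_cv, fs_sD] at h ⊢
  linear_combination -(dsym β l q * fs f q) * h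

/-! ### Integral inequalities in `ℝ≥0∞` -/

lemma lintegral_rpow_le_measure_univ {X : Type*} [MeasurableSpace X] {μ : Measure X} {p : ℝ}
    (hp : 1 ≤ p) {F : X → ℝ≥0∞} (hF : AEMeasurable F μ) :
    (∫⁻ x, F x ∂μ) ^ p ≤ μ Set.univ ^ (p - 1) * ∫⁻ x, F x ^ p ∂μ := by
  have h := eLpNorm'_le_eLpNorm'_mul_rpow_measure_univ (f := F) (μ := μ) zero_lt_one hp
    hF.aestronglyMeasurable
  simp only [eLpNorm'_eq_lintegral_enorm, enorm_eq_self, ENNReal.rpow_one, div_one] at h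
  have hp0 : 0 < p := by linarith
  calc _ ≤ ((∫⁻ x, F x ^ p ∂μ) ^ (1 / p) * μ Set.univ ^ (1 - 1 / p)) ^ p := by gcongr
    _ = _ := by
      rw [ENNReal.mul_rpow_of_nonneg _ _ hp0.le, ← ENNReal.rpow_mul, ← ENNReal.rpow_mul, mul_comm]
      congr 2
      · field_simp
      · field_simp; simp

lemma lintegral_mul_rpow_le {X : Type*} [MeasurableSpace X] {μ : Measure X} {p : ℝ}
    (hp : 1 ≤ p) {k F : X → ℝ≥0∞} (hk : Measurable k) (hF : Measurable F) :
    (∫⁻ x, k x * F x ∂μ) ^ p ≤ (∫⁻ x, k x ∂μ) ^ (p - 1) * ∫⁻ x, k x * F x ^ p ∂μ := by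
  have h := lintegral_rpow_le_measure_univ (μ := μ.withDensity k) hp hF.aemeasurable
  rwa [lintegral_withDensity_eq_lintegral_mul _ hk hF,
    lintegral_withDensity_eq_lintegral_mul _ hk (hF.pow_const p),
    withDensity_apply _ MeasurableSet.univ, Measure.restrict_univ] at h

lemma tsum_mul_rpow_le {p : ℝ} (hp : 1 ≤ p) (u x : ℕ → ℝ≥0∞) :
    (∑' j, u j * x j) ^ p ≤ (∑' j, u j) ^ (p - 1) * ∑' j, u j * x j ^ p := by
  have h := lintegral_mul_rpow_le (μ := Measure.count) hp (k := u) (F := x)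
    (measurable_of_countable _) (measurable_of_countable _)
  simpa only [lintegral_count] using h

lemma add_rpow_le {p : ℝ} (hp : 1 ≤ p) (a b : ℝ≥0∞) :
    (a + b) ^ p ≤ 2 ^ (p - 1) * (a ^ p + b ^ p) :=
  ENNReal.rpow_add_le_mul_rpow_add_rpow a b hp

lemma sum_rpow_le {ι : Type*} {p : ℝ} (hp : 1 ≤ p) (s : Finset ι) (x : ι → ℝ≥0∞) :
    (∑ j ∈ s, x j) ^ p ≤ (s.card : ℝ≥0∞) ^ (p - 1) * ∑ j ∈ s, x j ^ p :=
  ENNReal.rpow_sum_le_const_mul_sum_rpow s x hp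

/-- The `p`-th power of the `Lᵖ` norm. -/
def ip {X : Type*} [MeasureSpace X] (p : ℝ) (g : X → ℂ) : ℝ≥0∞ := ∫⁻ x, ‖g x‖ₑ ^ p

lemma eLpNorm_rpow_eq_ip {X : Type*} [MeasureSpace X] {p : ℝ} (hp : 1 ≤ p) (g : X → ℂ) :
    eLpNorm g (ENNReal.ofReal p) volume ^ p = ip p g := by
  have hp0 : 0 < p := by linarith
  rw [eLpNorm_eq_lintegral_rpow_enorm_toReal (by simpa using hp0) ENNReal.ofReal_ne_top,
    ENNReal.toReal_ofReal hp0.le, ← ENNReal.rpow_mul, one_div, inv_mul_cancel₀ hp0.ne',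
    ENNReal.rpow_one, ip]

instance isAddHaarMeasure_volume : (volume : Measure (Rn1 n)).IsAddHaarMeasure :=
  Measure.prod.instIsAddHaarMeasure _ _

lemma ip_cv_le {p : ℝ} (hp : 1 ≤ p) (K g : 𝓢(Rn1 n, ℂ)) :
    ip p (cv K g) ≤ (∫⁻ x, ‖K x‖ₑ) ^ p * ip p g := by
  have hK := K.continuous.measurable.enorm
  have hg := g.continuous.measurable.enorm
  have hpt : ∀ x, ‖cv K g x‖ₑ ≤ ∫⁻ y, ‖K y‖ₑ * ‖g (x - y)‖ₑ := by
    intro x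
    rw [cv_apply, conv1]
    refine (enorm_integral_le_lintegral_enorm _).trans_eq ?_
    rw [← lintegral_sub_left_eq_self _ x]
    simp [enorm_mul]
  have hm : Measurable fun z : Rn1 n × Rn1 n => ‖K z.2‖ₑ * ‖g (z.1 - z.2)‖ₑ ^ p := by
    have := hg.comp (measurable_fst.sub (measurable_snd (α := Rn1 n) (β := Rn1 n)))
    exact (hK.comp measurable_snd).mul (this.pow_const p)
  calc ip p (cv K g)
      ≤ ∫⁻ x, (∫⁻ y, ‖K y‖ₑ) ^ (p - 1) * ∫⁻ y, ‖K y‖ₑ * ‖g (x - y)‖ₑ ^ p := by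
        refine lintegral_mono fun x => ?_
        refine (ENNReal.rpow_le_rpow (hpt x) (by linarith)).trans ?_
        exact lintegral_mul_rpow_le hp hK (hg.comp (measurable_const.sub measurable_id))
    _ = (∫⁻ y, ‖K y‖ₑ) ^ (p - 1) * ∫⁻ x, ∫⁻ y, ‖K y‖ₑ * ‖g (x - y)‖ₑ ^ p := by
        rw [lintegral_const_mul _ hm.lintegral_prod_right']
    _ = (∫⁻ y, ‖K y‖ₑ) ^ (p - 1) * ((∫⁻ y, ‖K y‖ₑ) * ip p g) := by
        rw [lintegral_lintegral_swap hm.aemeasurable]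
        congr 1
        rw [← lintegral_mul_const _ hK]
        refine lintegral_congr fun y => ?_
        rw [lintegral_const_mul _ (by
          exact (hg.comp (measurable_id.sub measurable_const)).pow_const p),
          lintegral_sub_right_eq_self (fun x => ‖g x‖ₑ ^ p) y, ip]
    _ = _ := by
        rw [← mul_assoc]
        congr 1
        nth_rw 2 [← ENNReal.rpow_one (∫⁻ y, ‖K y‖ₑ)]
        rw [← ENNReal.rpow_add_of_nonneg _ _ (by linarith) (by norm_num)]
        ring_nf

lemma eLpNorm_cv_le {p : ℝ} (hp : 1 ≤ p) (K g : 𝓢(Rn1 n, ℂ)) :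
    pNorm p (cv K g) ≤ (∫⁻ x, ‖K x‖ₑ) * pNorm p g := by
  have hp0 : 0 < p := by linarith
  rw [← ENNReal.rpow_le_rpow_iff hp0, ENNReal.mul_rpow_of_nonneg _ _ hp0.le, pNorm, pNorm,
    eLpNorm_rpow_eq_ip hp, eLpNorm_rpow_eq_ip hp]
  exact ip_cv_le hp K g

/-- A pointwise convergent series is bounded in `Lᵖ` by the sum of the norms. -/
lemma eLpNorm_le_tsum_of_tendsto {p : ℝ} (hp : 1 ≤ p) {b : ℕ → Rn1 n → ℂ} {g : Rn1 n → ℂ}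
    (hb : ∀ j, Continuous (b j))
    (h : ∀ x, Filter.Tendsto (fun J => ∑ j ∈ Finset.range (J + 1), b j x) Filter.atTop
      (nhds (g x))) :
    pNorm p g ≤ ∑' j, pNorm p (b j) := by
  refine (Lp.eLpNorm_lim_le_liminf_eLpNorm (μ := volume) (p := ENNReal.ofReal p)
    (f := fun J => fun x => ∑ j ∈ Finset.range (J + 1), b j x) (fun J => ?_) g
    (.of_forall h)).trans ?_
  · exact (continuous_finsetSum _ fun j _ => hb j).aestronglyMeasurable
  · refine Filter.liminf_le_of_le ?_ fun c hc => ?_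
    · isBoundedDefault
    obtain ⟨J, hJ⟩ := hc.exists
    refine hJ.trans ?_
    have := eLpNorm_sum_le (μ := volume) (p := ENNReal.ofReal p)
      (s := Finset.range (J + 1)) (f := b) (fun j _ => (hb j).aestronglyMeasurable)
      (by simpa using ENNReal.ofReal_le_ofReal hp)
    refine le_trans ?_ (this.trans (ENNReal.sum_le_tsum _))
    apply le_of_eq; congr 1; ext x; simp

/-! ### Dyadic sums -/

lemma exists_tsum_scale_le {Λ δ : ℝ} (hΛ : 1 < Λ) (hδ : 0 < δ) (B : ℝ≥0) {g : ℝ → ℝ≥0∞}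
    (h1 : ∀ x, 0 < x → g x ≤ B * ENNReal.ofReal (x ^ δ))
    (h2 : ∀ x, 0 < x → g x ≤ B * ENNReal.ofReal (x ^ (-δ))) :
    ∃ C : ℝ≥0, ∀ r, 0 < r → ∑' j : ℕ, g (Λ ^ j * r) ≤ C := by
  have hΛ0 : 0 < Λ := by linarith
  set w : ℤ → ℝ := fun m => (Λ ^ (-δ)) ^ m.natAbs with hw
  have hlt : Λ ^ (-δ) < 1 := Real.rpow_lt_one_of_one_lt_of_neg hΛ (by linarith)
  have hws : Summable w := by
    refine Summable.of_nat_of_neg ?_ ?_ <;>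
    simpa [hw] using summable_geometric_of_lt_one (by positivity) hlt
  refine ⟨B * Real.toNNReal (Λ ^ δ) * Real.toNNReal (∑' m, w m), fun r hr => ?_⟩
  obtain ⟨k, hk1, hk2⟩ := exists_mem_Ico_zpow hr (hΛ)
  have key : ∀ j : ℕ, g (Λ ^ j * r) ≤ B * ENNReal.ofReal (Λ ^ δ) * ENNReal.ofReal (w (j + k)) := by
    intro j
    have hx0 : 0 < Λ ^ j * r := by positivity
    have hx1 : Λ ^ ((j : ℤ) + k) ≤ Λ ^ j * r := by
      rw [zpow_add₀ hΛ0.ne', zpow_natCast]; gcongr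
    have hx2 : Λ ^ j * r ≤ Λ ^ ((j : ℤ) + k + 1) := by
      rw [add_assoc, zpow_add₀ hΛ0.ne', zpow_natCast]; gcongr
    rw [mul_assoc, ← ENNReal.ofReal_mul (by positivity)]
    rcases le_total 0 ((j : ℤ) + k) with hm | hm
    · refine (h2 _ hx0).trans ?_
      gcongr
      calc (Λ ^ j * r) ^ (-δ) ≤ (Λ ^ ((j : ℤ) + k)) ^ (-δ) :=
            Real.rpow_le_rpow_of_nonpos (by positivity) hx1 (by linarith)
        _ = w (j + k) := by
            lift (j : ℤ) + k to ℕ using hm with m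
            simp only [hw, zpow_natCast, Int.natAbs_natCast]
            rw [← Real.rpow_natCast, ← Real.rpow_natCast, ← Real.rpow_mul hΛ0.le,
              ← Real.rpow_mul hΛ0.le, mul_comm]
        _ ≤ Λ ^ δ * w (j + k) := by
            refine le_mul_of_one_le_left (by positivity) (Real.one_le_rpow hΛ.le hδ.le)
    · refine (h1 _ hx0).trans ?_
      gcongr
      calc (Λ ^ j * r) ^ δ ≤ (Λ ^ ((j : ℤ) + k + 1)) ^ δ :=
            Real.rpow_le_rpow (by positivity) hx2 hδ.le
        _ = Λ ^ δ * w (j + k) := by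
            obtain ⟨m, hm'⟩ := Int.exists_eq_neg_ofNat hm
            rw [hm', zpow_add₀ hΛ0.ne', zpow_one, Real.mul_rpow (by positivity) hΛ0.le]
            simp only [hw, zpow_neg, zpow_natCast, Int.natAbs_neg, Int.natAbs_natCast]
            rw [mul_comm, Real.inv_rpow (by positivity), Real.rpow_neg hΛ0.le, inv_pow,
              ← Real.rpow_natCast, ← Real.rpow_natCast, ← Real.rpow_mul hΛ0.le,
              ← Real.rpow_mul hΛ0.le, mul_comm (m : ℝ)]
  calc ∑' j : ℕ, g (Λ ^ j * r)
      ≤ ∑' j : ℕ, B * ENNReal.ofReal (Λ ^ δ) * ENNReal.ofReal (w (j + k)) :=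
        ENNReal.tsum_le_tsum key
    _ = B * ENNReal.ofReal (Λ ^ δ) * ∑' j : ℕ, ENNReal.ofReal (w (j + k)) := ENNReal.tsum_mul_left
    _ ≤ B * ENNReal.ofReal (Λ ^ δ) * ∑' m : ℤ, ENNReal.ofReal (w m) := by
        gcongr
        exact ENNReal.tsum_comp_le_tsum_of_injective (f := fun j : ℕ => (j : ℤ) + k)
          (fun a b hab => by simpa using hab) (fun m => ENNReal.ofReal (w m))
    _ = _ := by
        rw [← ENNReal.ofReal_tsum_of_nonneg (fun m => by positivity) hws]
        simp [ENNReal.ofReal]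

/-! ### Reconstruction from the blocks -/

lemma enorm_le_seminorm (f : 𝓢(Rn1 n, ℂ)) (x : Rn1 n) :
    ‖f x‖ ≤ SchwartzMap.seminorm ℂ 0 0 f := SchwartzMap.norm_le_seminorm ℂ f x

lemma ParabolicLP.tendsto_cv_psiDil (P : ParabolicLP n) (g : 𝓢(Rn1 n, ℂ)) (x : Rn1 n) :
    Filter.Tendsto (fun J => cv (P.psiDil J) g x) Filter.atTop (nhds (g x)) := by
  have h1 : ∀ J, cv (P.psiDil J) g x = ∫ z, P.ψ z * g (x - dsc ((2 ^ J)⁻¹) z) := by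
    intro J
    rw [← integral_dsc (a := 2 ^ J) (by positivity) fun z => P.ψ z * g (x - dsc ((2 ^ J)⁻¹) z),
      cv_apply, conv1, ← integral_sub_left_eq_self _ volume x]
    refine integral_congr_ae (.of_forall fun y => ?_)
    simp only [psiDil, dil_apply, sub_sub_cancel, dsc_dsc]
    rw [inv_mul_cancel₀ (by positivity), dsc_one]
    ring
  simp only [h1]
  have h2 : g x = ∫ z, P.ψ z * g x := by rw [integral_mul_const, P.integral_psi, one_mul]
  rw [h2]
  refine tendsto_integral_of_dominated_convergence
    (fun z => ‖P.ψ z‖ * SchwartzMap.seminorm ℂ 0 0 g) (fun J => ?_) ?_ (fun J => ?_) ?_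
  · have := measurable_dsc (n := n) ((2 ^ J)⁻¹)
    exact (P.ψ.continuous.measurable.mul
      (g.continuous.measurable.comp (measurable_const.sub this))).aestronglyMeasurable
  · exact P.ψ.integrable.norm.mul_const _
  · refine .of_forall fun z => ?_
    rw [norm_mul]
    gcongr
    exact enorm_le_seminorm _ _
  · refine .of_forall fun z => ?_
    have h3 : Filter.Tendsto (fun J : ℕ => ((2 : ℝ) ^ J)⁻¹) Filter.atTop (nhds 0) := by
      simpa using tendsto_pow_atTop_nhds_zero_of_lt_one (r := (2 : ℝ)⁻¹) (by norm_num) (by norm_num)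
    have h4 : Continuous fun a : ℝ => P.ψ z * g (x - dsc a z) := by
      have := g.continuous
      unfold dsc; fun_prop
    have h5 : dsc 0 z = 0 := by ext <;> simp [dsc]
    have h6 := (h4.tendsto 0).comp h3
    rwa [h5, sub_zero] at h6

lemma ParabolicLP.pNorm_le_tsum (P : ParabolicLP n) {p : ℝ} (hp : 1 ≤ p) (g : 𝓢(Rn1 n, ℂ)) :
    pNorm p g ≤ ∑' j, pNorm p (cv (P.blk j) g) := by
  refine eLpNorm_le_tsum_of_tendsto hp (fun j => (cv (P.blk j) g).continuous) fun x => ?_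
  refine (P.tendsto_cv_psiDil g x).congr fun J => ?_
  rw [← P.sum_blk, cv_sum, sum_apply]

/-- The `L¹` norm. -/
def lone (g : 𝓢(Rn1 n, ℂ)) : ℝ≥0∞ := ∫⁻ x, ‖g x‖ₑ

lemma lone_lt_top (g : 𝓢(Rn1 n, ℂ)) : lone g < ⊤ := g.integrable.2

lemma pNorm_smul (p : ℝ) (c : ℂ) (g : 𝓢(Rn1 n, ℂ)) :
    pNorm p ⇑(c • g) = ‖c‖ₑ * pNorm p g := by
  rw [pNorm, pNorm, ← eLpNorm_const_smul]; rfl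

lemma ParabolicLP.pNorm_sD_le (P : ParabolicLP n) {p : ℝ} (hp : 1 ≤ p)
    (T : 𝓢(Rn1 n, ℂ) →ₗ[ℂ] 𝓢(Rn1 n, ℂ)) (hT : ∀ f g, cv (T f) g = T (cv f g))
    (β : Fin n → ℕ) (l : ℕ) (f : 𝓢(Rn1 n, ℂ)) :
    pNorm p (T (sD β l f)) ≤ ∑' j : ℕ, ENNReal.ofReal ((2 ^ j) ^ ((∑ k, β k) + 2 * l)) *
      lone (T (dil (2 ^ j) (by positivity) (sD β l P.fat))) * pNorm p (cv (P.blk j) f) := by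
  refine (P.pNorm_le_tsum hp _).trans (ENNReal.tsum_le_tsum fun j => ?_)
  rw [cv_comm, hT, cv_comm, P.cv_blk_sD, map_smul, ← hT, pNorm_smul, mul_assoc]
  gcongr
  · apply le_of_eq
    rw [← ofReal_norm, norm_pow, Complex.norm_real, Real.norm_of_nonneg (by positivity)]
  · exact eLpNorm_cv_le hp _ _

/-! ### Differences -/

/-- The first difference `f(· + v) - f`. -/
def dif (v : Rn1 n) : 𝓢(Rn1 n, ℂ) →ₗ[ℂ] 𝓢(Rn1 n, ℂ) :=
  (SchwartzMap.compSubConstCLM ℂ (-v)).toLinearMap - LinearMap.id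

/-- The second difference `f(· + v) - 2 f + f(· - v)`. -/
def dif2 (v : Rn1 n) : 𝓢(Rn1 n, ℂ) →ₗ[ℂ] 𝓢(Rn1 n, ℂ) :=
  (SchwartzMap.compSubConstCLM ℂ v).toLinearMap ∘ₗ dif v ∘ₗ dif v

lemma dif_apply (v : Rn1 n) (f : 𝓢(Rn1 n, ℂ)) (x : Rn1 n) : dif v f x = f (x + v) - f x := by
  simp [dif]

lemma dif_eq (v : Rn1 n) (f : 𝓢(Rn1 n, ℂ)) : dif v f = sh v f - f := rfl

lemma dif2_eq (v : Rn1 n) (f : 𝓢(Rn1 n, ℂ)) : dif2 v f = sh (-v) (dif v (dif v f)) := by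
  simp [dif2, sh]

lemma dif2_apply (v : Rn1 n) (f : 𝓢(Rn1 n, ℂ)) (x : Rn1 n) :
    dif2 v f x = f (x + v) - 2 * f x + f (x - v) := by
  rw [dif2_eq, sh_apply, dif_apply, dif_apply, dif_apply, ← sub_eq_add_neg, sub_add_cancel]
  ring

lemma cv_dif (v : Rn1 n) (f g : 𝓢(Rn1 n, ℂ)) : cv (dif v f) g = dif v (cv f g) := by
  rw [dif_eq, dif_eq, sub_eq_add_neg, sub_eq_add_neg, ← cv_sh, ← neg_one_smul ℂ f,
    ← neg_one_smul ℂ (cv f g), ← cv_smul]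
  exact fs_injective fun q => by simp only [fs_cv, fs_add, add_apply, add_mul]

lemma cv_dif2 (v : Rn1 n) (f g : 𝓢(Rn1 n, ℂ)) : cv (dif2 v f) g = dif2 v (cv f g) := by
  rw [dif2_eq, dif2_eq, cv_sh, cv_dif, cv_dif]

lemma dif_dil {a : ℝ} (ha : a ≠ 0) (v : Rn1 n) (f : 𝓢(Rn1 n, ℂ)) :
    dif v (dil a ha f) = dil a ha (dif (dsc a v) f) := by
  ext x
  simp only [dif_apply, dil_apply, ← dscEquiv_apply ha, map_add]
  ring

lemma dif2_dil {a : ℝ} (ha : a ≠ 0) (v : Rn1 n) (f : 𝓢(Rn1 n, ℂ)) :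
    dif2 v (dil a ha f) = dil a ha (dif2 (dsc a v) f) := by
  ext x
  simp only [dif2_apply, dil_apply, ← dscEquiv_apply ha, map_add, map_sub]
  ring

lemma lone_sh (v : Rn1 n) (f : 𝓢(Rn1 n, ℂ)) : lone (sh v f) = lone f := by
  simp only [lone, sh_apply]
  exact lintegral_add_right_eq_self (fun x => ‖f x‖ₑ) v

lemma lone_dif_le_two (v : Rn1 n) (f : 𝓢(Rn1 n, ℂ)) : lone (dif v f) ≤ 2 * lone f := by
  calc lone (dif v f) ≤ ∫⁻ x, (‖sh v f x‖ₑ + ‖f x‖ₑ) :=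
        lintegral_mono fun x => enorm_sub_le
    _ = lone (sh v f) + lone f := lintegral_add_left (sh v f).continuous.measurable.enorm _
    _ = _ := by rw [lone_sh, two_mul]

lemma lone_dif_le (v : Rn1 n) (f : 𝓢(Rn1 n, ℂ)) : lone (dif v f) ≤ lone (∂_{v} f) := by
  have hc : Continuous fun z : Rn1 n × ℝ => (∂_{v} f) (z.1 + z.2 • v) := by
    have := (∂_{v} f).continuous
    fun_prop
  have hpt : ∀ x, ‖dif v f x‖ₑ ≤ ∫⁻ θ in Set.Ioc (0 : ℝ) 1, ‖(∂_{v} f) (x + θ • v)‖ₑ := by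
    intro x
    have hd : ∀ θ : ℝ, HasDerivAt (fun θ : ℝ => f (x + θ • v)) ((∂_{v} f) (x + θ • v)) θ := by
      intro θ
      have h1 : HasDerivAt (fun θ : ℝ => x + θ • v) v θ := by
        simpa using ((hasDerivAt_id θ).smul_const v).const_add x
      exact ((f.differentiable (x + θ • v)).hasFDerivAt).comp_hasDerivAt θ h1
    have h2 := intervalIntegral.integral_eq_sub_of_hasDerivAt (a := 0) (b := 1)
      (fun θ _ => hd θ) (Continuous.intervalIntegrable (by
        exact hc.comp (by fun_prop : Continuous fun θ : ℝ => (x, θ))) _ _)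
    rw [dif_apply]
    simp only [one_smul, zero_smul, add_zero] at h2
    rw [← h2, intervalIntegral.integral_of_le zero_le_one]
    exact enorm_integral_le_lintegral_enorm _
  calc lone (dif v f) ≤ ∫⁻ x, ∫⁻ θ in Set.Ioc (0 : ℝ) 1, ‖(∂_{v} f) (x + θ • v)‖ₑ :=
        lintegral_mono hpt
    _ = ∫⁻ θ in Set.Ioc (0 : ℝ) 1, ∫⁻ x, ‖(∂_{v} f) (x + θ • v)‖ₑ :=
        lintegral_lintegral_swap hc.measurable.enorm.aemeasurable
    _ = ∫⁻ θ in Set.Ioc (0 : ℝ) 1, lone (∂_{v} f) := by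
        refine lintegral_congr fun θ => ?_
        exact lintegral_add_right_eq_self (μ := volume) (fun x => ‖(∂_{v} f) x‖ₑ) (θ • v)
    _ = _ := by simp

lemma lone_lineDeriv_X_le (Y : Rn n) (f : 𝓢(Rn1 n, ℂ)) :
    lone (∂_{((Y, 0) : Rn1 n)} f) ≤ ‖Y‖ₑ * ∑ k, lone (sdX k f) := by
  have h : ∂_{((Y, 0) : Rn1 n)} f = ∑ k, (Y k : ℂ) • sdX k f := by
    refine fs_injective fun q => ?_
    rw [fs_lineDeriv, fs_sum, sum_apply]
    simp only [fs_smul, smul_apply, fs_sdX, smul_eq_mul]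
    push_cast
    simp only [mul_zero, add_zero, Finset.sum_mul, Finset.mul_sum]
    exact Finset.sum_congr rfl fun k _ => by ring
  rw [h, Finset.mul_sum]
  unfold lone
  calc _ ≤ ∫⁻ x, ∑ k, ‖Y‖ₑ * ‖sdX k f x‖ₑ := by
        refine lintegral_mono fun x => ?_
        rw [sum_apply]
        refine (enorm_sum_le _ _).trans (Finset.sum_le_sum fun k _ => ?_)
        rw [smul_apply, smul_eq_mul, enorm_mul]
        gcongr
        rw [← ofReal_norm, ← ofReal_norm]
        refine ENNReal.ofReal_le_ofReal ?_
        rw [Complex.norm_real]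
        exact PiLp.norm_apply_le Y k
    _ = _ := by
        rw [lintegral_finsetSum _ fun k _ => (sdX k f).continuous.measurable.enorm.const_mul _]
        exact Finset.sum_congr rfl fun k _ =>
          lintegral_const_mul _ (sdX k f).continuous.measurable.enorm

lemma lone_lineDeriv_T (h : ℝ) (f : 𝓢(Rn1 n, ℂ)) :
    lone (∂_{((0, h) : Rn1 n)} f) = ‖h‖ₑ * lone (sdT f) := by
  have h' : ∂_{((0, h) : Rn1 n)} f = (h : ℂ) • sdT f := by
    refine fs_injective fun q => ?_
    rw [fs_lineDeriv, fs_smul, smul_apply, fs_sdT]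
    simp
    ring
  rw [h', lone, lone, ← lintegral_const_mul _ (sdT f).continuous.measurable.enorm]
  refine lintegral_congr fun x => ?_
  rw [smul_apply, smul_eq_mul, enorm_mul, ← ofReal_norm, Complex.norm_real, ofReal_norm]

lemma exists_lone_dif_T_le (f : 𝓢(Rn1 n, ℂ)) :
    ∃ B : ℝ≥0, ∀ h : ℝ, lone (dif (0, h) f) ≤ B * ENNReal.ofReal (min 1 |h|) := by
  lift 2 * lone f + lone (sdT f) to ℝ≥0 using by
    simp [ENNReal.mul_eq_top, (lone_lt_top _).ne] with B hB
  refine ⟨B, fun h => ?_⟩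
  rw [hB]
  rcases le_total 1 |h| with h1 | h1
  · rw [min_eq_left h1, ENNReal.ofReal_one, mul_one]
    exact (lone_dif_le_two _ _).trans le_self_add
  · rw [min_eq_right h1]
    refine (lone_dif_le _ _).trans ?_
    rw [lone_lineDeriv_T, mul_comm, ← ofReal_norm, Real.norm_eq_abs]
    gcongr
    exact le_add_self

lemma exists_lone_dif2_X_le (f : 𝓢(Rn1 n, ℂ)) :
    ∃ B : ℝ≥0, ∀ Y : Rn n, lone (dif2 (Y, 0) f) ≤ B * ENNReal.ofReal (min 1 (‖Y‖ ^ 2)) := by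
  lift 2 * (2 * lone f) + ∑ k, ∑ m, lone (sdX m (sdX k f)) to ℝ≥0 using by
    simp [ENNReal.mul_eq_top, (lone_lt_top _).ne] with B hB
  refine ⟨B, fun Y => ?_⟩
  rw [hB, dif2_eq, lone_sh]
  rcases le_total 1 (‖Y‖ ^ 2) with h1 | h1
  · rw [min_eq_left h1, ENNReal.ofReal_one, mul_one]
    refine (lone_dif_le_two _ _).trans ?_
    grw [lone_dif_le_two]
    exact le_self_add
  · rw [min_eq_right h1]
    have hcomm : ∂_{((Y, 0) : Rn1 n)} (dif (Y, 0) f) = dif (Y, 0) (∂_{((Y, 0) : Rn1 n)} f) := by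
      rw [dif_eq, dif_eq]
      ext x
      simp only [SchwartzMap.lineDerivOp_apply_eq_fderiv, sub_apply, sh_apply]
      have : ⇑(sh (Y, 0) f - f) = fun x => f (x + (Y, 0)) - f x := by
        ext x; simp [sh_apply]
      rw [this, fderiv_fun_sub (by
        exact (f.differentiable.comp (differentiable_id.add_const _)) x) (f.differentiable x),
        fderiv_comp_add_right]
      rfl
    have hcomm2 : ∀ k, sdX k (∂_{((Y, 0) : Rn1 n)} f) = ∂_{((Y, 0) : Rn1 n)} (sdX k f) := by
      intro k
      refine fs_injective fun q => ?_
      rw [fs_sdX, fs_lineDeriv, fs_lineDeriv, fs_sdX]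
      ring
    grw [lone_dif_le, hcomm, lone_dif_le, lone_lineDeriv_X_le]
    simp only [hcomm2]
    calc _ ≤ ‖Y‖ₑ * ∑ k, ‖Y‖ₑ * ∑ m, lone (sdX m (sdX k f)) := by
          gcongr; exact lone_lineDeriv_X_le _ _
      _ = ‖Y‖ₑ ^ 2 * ∑ k, ∑ m, lone (sdX m (sdX k f)) := by
          rw [← Finset.mul_sum, sq, mul_assoc]
      _ ≤ _ := by
          rw [mul_comm, ENNReal.ofReal_pow (norm_nonneg _), ofReal_norm]
          gcongr
          exact le_add_self

/-! ### Scale-invariant kernels -/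

section kernel

variable {V : Type*} [NormedAddCommGroup V] [NormedSpace ℝ V] [FiniteDimensional ℝ V]
  [MeasureSpace V] [BorelSpace V] [(volume : Measure V).IsAddHaarMeasure]

lemma lintegral_kernel_lt_top [Nontrivial V] {σ m : ℝ} (hσ : 0 < σ) (hm : σ < m) :
    ∫⁻ Y : V, ENNReal.ofReal (‖Y‖ ^ (-(Module.finrank ℝ V + σ)) * min 1 (‖Y‖ ^ m)) < ⊤ := by
  have hint : Integrable fun Y : V => ‖Y‖ ^ (-(Module.finrank ℝ V + σ)) * min 1 (‖Y‖ ^ m) := by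
    rw [integrable_fun_norm_addHaar (μ := volume)
      (f := fun r : ℝ => r ^ (-(Module.finrank ℝ V + σ)) * min 1 (r ^ m))]
    have hd : ((Module.finrank ℝ V - 1 : ℕ) : ℝ) = Module.finrank ℝ V - 1 := by
      rw [Nat.cast_sub (Module.finrank_pos (R := ℝ) (M := V))]; simp
    have hp : ∀ r : ℝ, 0 < r → r ^ (Module.finrank ℝ V - 1) * r ^ (-(Module.finrank ℝ V + σ)) =
        r ^ (-1 - σ) := by
      intro r hr
      rw [← Real.rpow_natCast, ← Real.rpow_add hr, hd]
      ring_nf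
    rw [← Set.Ioo_union_Ici_eq_Ioi zero_lt_one]
    refine IntegrableOn.union ?_ ?_
    · refine ((intervalIntegral.integrableOn_Ioo_rpow_iff zero_lt_one (s := m - 1 - σ)).2
        (by linarith)).congr_fun (fun r hr => ?_) measurableSet_Ioo
      have h1 : r ^ m ≤ 1 := Real.rpow_le_one hr.1.le hr.2.le (by linarith)
      simp only [smul_eq_mul, min_eq_right h1]
      rw [← mul_assoc, hp r hr.1, ← Real.rpow_add hr.1]
      ring_nf
    · rw [integrableOn_Ici_iff_integrableOn_Ioi]
      refine (integrableOn_Ioi_rpow_of_lt (a := -1 - σ) (by linarith) zero_lt_one).congr_fun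
        (fun r hr => ?_) measurableSet_Ioi
      have hr1 : 1 < r := hr
      have h1 : 1 ≤ r ^ m := Real.one_le_rpow hr1.le (by linarith)
      simp only [smul_eq_mul, min_eq_left h1]
      rw [mul_one, hp r (by linarith)]
  exact hint.lintegral_lt_top

lemma lintegral_comp_dilate {lam : ℝ} (hl : 0 < lam) {F : V → ℝ≥0∞} (hF : Measurable F) :
    ∫⁻ Y : V, ENNReal.ofReal (lam ^ Module.finrank ℝ V) * F (lam • Y) = ∫⁻ Y : V, F Y := by
  rw [lintegral_const_mul (f := fun Y => F (lam • Y)) _ (hF.comp (measurable_const_smul lam)),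
    ← lintegral_map hF (measurable_const_smul lam),
    Measure.map_addHaar_smul volume hl.ne', lintegral_smul_measure, smul_eq_mul, ← mul_assoc,
    abs_of_pos (by positivity), ← ENNReal.ofReal_mul (by positivity),
    mul_inv_cancel₀ (by positivity)]
  simp

lemma lintegral_kernel_dilate {σ m lam : ℝ} (hl : 0 < lam) :
    ∫⁻ Y : V, ENNReal.ofReal (‖Y‖ ^ (-(Module.finrank ℝ V + σ)) *
        (lam ^ (-σ) * min 1 ((lam * ‖Y‖) ^ m))) =
      ∫⁻ Y : V, ENNReal.ofReal (‖Y‖ ^ (-(Module.finrank ℝ V + σ)) * min 1 (‖Y‖ ^ m)) := by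
  rw [← lintegral_comp_dilate hl (F := fun Y : V => ENNReal.ofReal
    (‖Y‖ ^ (-(Module.finrank ℝ V + σ)) * min 1 (‖Y‖ ^ m))) (by fun_prop)]
  refine lintegral_congr fun Y => ?_
  rw [← ENNReal.ofReal_mul (by positivity)]
  congr 1
  rw [norm_smul, Real.norm_of_nonneg hl.le, Real.mul_rpow hl.le (norm_nonneg _) (z := -(_ + σ)),
    neg_add, Real.rpow_add hl, Real.rpow_neg hl.le, Real.rpow_neg hl.le,
    Real.rpow_natCast]
  field_simp

lemma exists_tsum_weight_le {Λ σ m : ℝ} (hΛ : 1 < Λ) (hσ : 0 < σ) (hm : σ < m) :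
    ∃ C : ℝ≥0, ∀ r : ℝ, 0 < r →
      ∑' j : ℕ, ENNReal.ofReal ((Λ ^ j) ^ (-σ) * min 1 ((Λ ^ j * r) ^ m)) ≤
        C * ENNReal.ofReal (r ^ σ) := by
  obtain ⟨C, hC⟩ := exists_tsum_scale_le hΛ (δ := min σ (m - σ)) (lt_min hσ (by linarith)) 1
    (g := fun x => ENNReal.ofReal (x ^ (-σ) * min 1 (x ^ m)))
    (fun x hx => by
      rw [ENNReal.coe_one, one_mul]
      refine ENNReal.ofReal_le_ofReal ?_
      rcases le_total x 1 with h | h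
      · calc x ^ (-σ) * min 1 (x ^ m) ≤ x ^ (-σ) * x ^ m := by gcongr; exact min_le_right _ _
          _ = x ^ (m - σ) := by rw [← Real.rpow_add hx]; ring_nf
          _ ≤ _ := Real.rpow_le_rpow_of_exponent_ge hx h (min_le_right _ _)
      · calc x ^ (-σ) * min 1 (x ^ m) ≤ x ^ (-σ) * 1 := by gcongr; exact min_le_left _ _
          _ ≤ _ := by
            rw [mul_one]
            refine Real.rpow_le_rpow_of_exponent_le h ?_
            have : 0 < min σ (m - σ) := lt_min hσ (by linarith)
            linarith)
    (fun x hx => by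
      rw [ENNReal.coe_one, one_mul]
      refine ENNReal.ofReal_le_ofReal ?_
      rcases le_total x 1 with h | h
      · calc x ^ (-σ) * min 1 (x ^ m) ≤ x ^ (-σ) * x ^ m := by gcongr; exact min_le_right _ _
          _ = x ^ (m - σ) := by rw [← Real.rpow_add hx]; ring_nf
          _ ≤ _ := by
            refine Real.rpow_le_rpow_of_exponent_ge hx h ?_
            have : 0 < min σ (m - σ) := lt_min hσ (by linarith)
            linarith
      · calc x ^ (-σ) * min 1 (x ^ m) ≤ x ^ (-σ) * 1 := by gcongr; exact min_le_left _ _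
          _ ≤ _ := by
            rw [mul_one]
            refine Real.rpow_le_rpow_of_exponent_le h ?_
            have := min_le_left σ (m - σ)
            linarith)
  refine ⟨C, fun r hr => ?_⟩
  grw [← hC r hr, ← ENNReal.tsum_mul_right]
  refine ENNReal.tsum_le_tsum fun j => ?_
  have hΛ0 : 0 < Λ := by linarith
  rw [← ENNReal.ofReal_mul (by positivity)]
  apply le_of_eq
  congr 1
  rw [Real.mul_rpow (by positivity) hr.le (z := -σ), Real.rpow_neg hr.le]
  field_simp

/-- A weighted Hardy-type inequality for dyadic sums of difference bounds. -/
lemma exists_lintegral_tsum_le [Nontrivial V] {p Λ σ m : ℝ} (hp : 1 ≤ p) (hΛ : 1 < Λ)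
    (hσ : 0 < σ) (hm : σ < m) :
    ∃ C : ℝ≥0, ∀ x : ℕ → ℝ≥0∞,
      ∫⁻ Y : V, ENNReal.ofReal (‖Y‖ ^ (-(Module.finrank ℝ V + p * σ))) *
        (∑' j, ENNReal.ofReal ((Λ ^ j) ^ (-σ) * min 1 ((Λ ^ j * ‖Y‖) ^ m)) * x j) ^ p ≤
      C * ∑' j, x j ^ p := by
  obtain ⟨C, hC⟩ := exists_tsum_weight_le hΛ hσ hm
  have hI := lintegral_kernel_lt_top (V := V) hσ hm
  lift ∫⁻ Y : V, ENNReal.ofReal (‖Y‖ ^ (-(Module.finrank ℝ V + σ)) * min 1 (‖Y‖ ^ m)) to ℝ≥0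
    using hI.ne with I hI'
  have hΛ0 : 0 < Λ := by linarith
  refine ⟨C ^ (p - 1) * I, fun x => ?_⟩
  have hpt : ∀ Y : V, ENNReal.ofReal (‖Y‖ ^ (-(Module.finrank ℝ V + p * σ))) *
        (∑' j, ENNReal.ofReal ((Λ ^ j) ^ (-σ) * min 1 ((Λ ^ j * ‖Y‖) ^ m)) * x j) ^ p ≤
      ∑' j, C ^ (p - 1) * x j ^ p * ENNReal.ofReal (‖Y‖ ^ (-(Module.finrank ℝ V + σ)) *
        ((Λ ^ j) ^ (-σ) * min 1 ((Λ ^ j * ‖Y‖) ^ m))) := by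
    intro Y
    rcases eq_or_ne Y 0 with rfl | hY
    · rw [norm_zero, Real.zero_rpow (by
        have : 0 < p * σ := by positivity
        have : (0 : ℝ) ≤ Module.finrank ℝ V := by positivity
        linarith)]
      simp
    have hr : 0 < ‖Y‖ := norm_pos_iff.2 hY
    grw [tsum_mul_rpow_le hp, hC _ hr]
    swap
    · linarith
    rw [ENNReal.mul_rpow_of_nonneg _ _ (by linarith), ENNReal.ofReal_rpow_of_pos (by positivity),
      ← ENNReal.tsum_mul_left, ← ENNReal.tsum_mul_left]
    refine ENNReal.tsum_le_tsum fun j => ?_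
    rw [ENNReal.ofReal_mul (p := ‖Y‖ ^ _) (by positivity)]
    have : ‖Y‖ ^ (-(Module.finrank ℝ V + σ)) =
        ‖Y‖ ^ (-(Module.finrank ℝ V + p * σ)) * (‖Y‖ ^ σ) ^ (p - 1) := by
      rw [← Real.rpow_mul hr.le, ← Real.rpow_add hr]
      ring_nf
    rw [this, ENNReal.ofReal_mul (p := ‖Y‖ ^ (-(Module.finrank ℝ V + p * σ))) (by positivity)]
    apply le_of_eq
    ring
  calc _ ≤ _ := lintegral_mono hpt
    _ = ∑' j, C ^ (p - 1) * x j ^ p * I := by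
        rw [lintegral_tsum fun j => by fun_prop]
        refine tsum_congr fun j => ?_
        rw [lintegral_const_mul _ (by fun_prop), lintegral_kernel_dilate (by positivity), hI']
    _ = _ := by
        rw [ENNReal.tsum_mul_right, ENNReal.tsum_mul_left, ENNReal.coe_mul,
          ENNReal.coe_rpow_of_nonneg _ (by linarith)]
        ring

end kernel

/-! ### Upper bounds by the Littlewood–Paley blocks -/

/-- The weighted norm `2^{jα} ‖Δ_j f‖_p` of the `j`-th block. -/
def bx (P : ParabolicLP n) (α p : ℝ) (f : 𝓢(Rn1 n, ℂ)) (j : ℕ) : ℝ≥0∞ :=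
  ENNReal.ofReal ((2 ^ j) ^ α) * pNorm p (cv (P.blk j) f)

lemma ParabolicLP.pNorm_sD_le_bx (P : ParabolicLP n) {p : ℝ} (hp : 1 ≤ p) (α : ℝ)
    (T : 𝓢(Rn1 n, ℂ) →ₗ[ℂ] 𝓢(Rn1 n, ℂ)) (hT : ∀ f g, cv (T f) g = T (cv f g))
    (β : Fin n → ℕ) (l : ℕ) (B : ℝ≥0) (v : ℕ → ℝ)
    (hv : ∀ j, lone (T (dil (2 ^ j) (by positivity) (sD β l P.fat))) ≤ B * ENNReal.ofReal (v j))
    (f : 𝓢(Rn1 n, ℂ)) :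
    pNorm p (T (sD β l f)) ≤ B * ∑' j : ℕ, ENNReal.ofReal
      ((2 ^ j) ^ (-(α - ((∑ k, β k) + 2 * l : ℕ))) * v j) * bx P α p f j := by
  refine (P.pNorm_sD_le hp T hT β l f).trans ?_
  rw [← ENNReal.tsum_mul_left]
  refine ENNReal.tsum_le_tsum fun j => ?_
  grw [hv j]
  rw [bx, ENNReal.ofReal_mul (by positivity)]
  have : ((2 : ℝ) ^ j) ^ ((∑ k, β k) + 2 * l) =
      (2 ^ j) ^ (-(α - ((∑ k, β k) + 2 * l : ℕ))) * (2 ^ j) ^ α := by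
    rw [← Real.rpow_natCast, ← Real.rpow_add (by positivity)]
    ring_nf
  rw [this, ENNReal.ofReal_mul (by positivity)]
  apply le_of_eq
  ring

lemma ParabolicLP.exists_pNorm_sD_le (P : ParabolicLP n) {p α : ℝ} (hp : 1 ≤ p)
    (β : Fin n → ℕ) (l : ℕ) (h : (((∑ k, β k) + 2 * l : ℕ) : ℝ) < α) :
    ∃ C : ℝ≥0, ∀ f : 𝓢(Rn1 n, ℂ), pNorm p (sD β l f) ^ p ≤ C * ∑' j, bx P α p f j ^ p := by
  set s := α - ((∑ k, β k) + 2 * l : ℕ) with hs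
  have hs0 : 0 < s := by linarith
  have hB := lone_lt_top (sD β l P.fat)
  lift lone (sD β l P.fat) to ℝ≥0 using hB.ne with B hB'
  have hlt : (2 : ℝ) ^ (-s) < 1 := Real.rpow_lt_one_of_one_lt_of_neg (by norm_num) (by linarith)
  have hu : ∀ j : ℕ, ((2 : ℝ) ^ j) ^ (-s) * 1 = (2 ^ (-s)) ^ j := by
    intro j
    rw [mul_one, ← Real.rpow_natCast, ← Real.rpow_natCast, ← Real.rpow_mul (by norm_num),
      ← Real.rpow_mul (by norm_num), mul_comm]
  have hsum := summable_geometric_of_lt_one (by positivity) hlt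
  set D : ℝ≥0 := Real.toNNReal (∑' j : ℕ, (2 ^ (-s)) ^ j)
  have hD : ∑' j : ℕ, ENNReal.ofReal (((2 : ℝ) ^ j) ^ (-s) * 1) = D := by
    simp only [hu]
    rw [← ENNReal.ofReal_tsum_of_nonneg (fun j => by positivity) hsum]
    rfl
  refine ⟨B ^ p * D ^ (p - 1) , fun f => ?_⟩
  have h1 := P.pNorm_sD_le_bx hp α LinearMap.id (fun _ _ => rfl) β l B (fun _ => 1) (fun j => by
    rw [LinearMap.id_apply, lone, lintegral_dil (by positivity), ENNReal.ofReal_one, mul_one, hB']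
    rfl) f
  rw [LinearMap.id_apply, ← hs] at h1
  grw [h1]
  rw [ENNReal.mul_rpow_of_nonneg _ _ (by linarith)]
  grw [tsum_mul_rpow_le hp, hD]
  have hle : ∀ j, ENNReal.ofReal (((2 : ℝ) ^ j) ^ (-s) * 1) ≤ 1 := by
    intro j
    rw [hu, ← ENNReal.ofReal_one]
    exact ENNReal.ofReal_le_ofReal (pow_le_one₀ (by positivity) hlt.le)
  calc _ ≤ (B : ℝ≥0∞) ^ p * (D ^ (p - 1) * ∑' j, 1 * bx P α p f j ^ p) := by
        gcongr with j; exact hle j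
    _ = _ := by
        rw [ENNReal.coe_mul, ENNReal.coe_rpow_of_nonneg _ (by linarith),
          ENNReal.coe_rpow_of_nonneg _ (by linarith)]
        simp only [one_mul, mul_assoc]

lemma ParabolicLP.exists_lintegral_dif_le (P : ParabolicLP n) {p s α : ℝ} (hp : 1 ≤ p)
    (β : Fin n → ℕ) (l : ℕ) (h : α - ((∑ k, β k) + 2 * l : ℕ) = s) (hs0 : 0 < s) (hs2 : s < 2) :
    ∃ C : ℝ≥0, ∀ f : 𝓢(Rn1 n, ℂ),
      ∫⁻ h : ℝ, ENNReal.ofReal (|h| ^ (-(1 + p * s / 2))) *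
        pNorm p (dif (0, h) (sD β l f)) ^ p ≤ C * ∑' j, bx P α p f j ^ p := by
  obtain ⟨B, hB⟩ := exists_lone_dif_T_le (sD β l P.fat)
  obtain ⟨C, hC⟩ := exists_lintegral_tsum_le (V := ℝ) (p := p) (Λ := 4) (σ := s / 2) (m := 1) hp
    (by norm_num) (by linarith) (by linarith)
  refine ⟨B ^ p * C, fun f => ?_⟩
  have h1 : ∀ t : ℝ, pNorm p (dif (0, t) (sD β l f)) ≤ B * ∑' j : ℕ, ENNReal.ofReal
      ((4 ^ j) ^ (-(s / 2)) * min 1 ((4 ^ j * ‖t‖) ^ (1 : ℝ))) * bx P α p f j := by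
    intro t
    refine (P.pNorm_sD_le_bx hp α (dif (0, t)) (cv_dif _) β l B (fun j => min 1 |(2 ^ j) ^ 2 * t|)
      (fun j => ?_) f).trans_eq ?_
    · rw [dif_dil, lone, lintegral_dil (by positivity)]
      simpa only [dsc, lone, smul_zero] using hB ((2 ^ j) ^ 2 * t)
    · rw [h]
      congr 1
      refine tsum_congr fun j => ?_
      have h4 : ((2 : ℝ) ^ j) ^ 2 = 4 ^ j := by rw [← pow_mul, mul_comm, pow_mul]; norm_num
      have h5 : ((4 : ℝ) ^ j) ^ (-(s / 2)) = (2 ^ j) ^ (-s) := by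
        rw [← h4, ← Real.rpow_natCast _ 2, ← Real.rpow_mul (by positivity)]
        congr 1
        push_cast
        ring
      rw [Real.rpow_one, abs_mul, abs_of_pos (by positivity), h4, h5, Real.norm_eq_abs]
  calc _ ≤ ∫⁻ t : ℝ, (B : ℝ≥0∞) ^ p * (ENNReal.ofReal (‖t‖ ^ (-(Module.finrank ℝ ℝ + p * (s / 2)))) *
        (∑' j : ℕ, ENNReal.ofReal ((4 ^ j) ^ (-(s / 2)) * min 1 ((4 ^ j * ‖t‖) ^ (1 : ℝ))) *
          bx P α p f j) ^ p) := by
        refine lintegral_mono fun t => ?_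
        beta_reduce
        grw [h1 t]
        rw [ENNReal.mul_rpow_of_nonneg _ _ (by linarith), Module.finrank_self, Nat.cast_one,
          Real.norm_eq_abs, mul_div_assoc, mul_left_comm]
    _ ≤ _ := by
        rw [lintegral_const_mul _ (by fun_prop)]
        grw [hC]
        rw [ENNReal.coe_mul, ENNReal.coe_rpow_of_nonneg _ (by linarith), mul_assoc]

lemma ParabolicLP.exists_lintegral_dif2_le (P : ParabolicLP n) (hn : 1 ≤ n) {p s α : ℝ}
    (hp : 1 ≤ p) (β : Fin n → ℕ) (l : ℕ) (h : α - ((∑ k, β k) + 2 * l : ℕ) = s)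
    (hs0 : 0 < s) (hs2 : s < 2) :
    ∃ C : ℝ≥0, ∀ f : 𝓢(Rn1 n, ℂ),
      ∫⁻ Y : Rn n, ENNReal.ofReal (‖Y‖ ^ (-((n : ℝ) + p * s))) *
        pNorm p (dif2 (Y, 0) (sD β l f)) ^ p ≤ C * ∑' j, bx P α p f j ^ p := by
  have : Nontrivial (Rn n) := by
    have : Nonempty (Fin n) := ⟨⟨0, hn⟩⟩
    infer_instance
  obtain ⟨B, hB⟩ := exists_lone_dif2_X_le (sD β l P.fat)
  obtain ⟨C, hC⟩ := exists_lintegral_tsum_le (V := Rn n) (p := p) (Λ := 2) (σ := s) (m := 2) hp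
    (by norm_num) (by linarith) (by linarith)
  refine ⟨B ^ p * C, fun f => ?_⟩
  have h1 : ∀ Y : Rn n, pNorm p (dif2 (Y, 0) (sD β l f)) ≤ B * ∑' j : ℕ, ENNReal.ofReal
      ((2 ^ j) ^ (-s) * min 1 ((2 ^ j * ‖Y‖) ^ (2 : ℝ))) * bx P α p f j := by
    intro Y
    refine (P.pNorm_sD_le_bx hp α (dif2 (Y, 0)) (cv_dif2 _) β l B
      (fun j => min 1 ((2 ^ j * ‖Y‖) ^ (2 : ℝ))) (fun j => ?_) f).trans_eq ?_
    · rw [dif2_dil, lone, lintegral_dil (by positivity)]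
      have h2 := hB ((2 : ℝ) ^ j • Y)
      rw [norm_smul, Real.norm_of_nonneg (by positivity), ← Real.rpow_natCast] at h2
      simpa [dsc, lone] using h2
    · rw [h]
  calc _ ≤ ∫⁻ Y : Rn n, (B : ℝ≥0∞) ^ p *
        (ENNReal.ofReal (‖Y‖ ^ (-(Module.finrank ℝ (Rn n) + p * s))) *
        (∑' j : ℕ, ENNReal.ofReal ((2 ^ j) ^ (-s) * min 1 ((2 ^ j * ‖Y‖) ^ (2 : ℝ))) *
          bx P α p f j) ^ p) := by
        refine lintegral_mono fun Y => ?_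
        beta_reduce
        grw [h1 Y]
        rw [ENNReal.mul_rpow_of_nonneg _ _ (by linarith), finrank_euclideanSpace_fin,
          mul_left_comm]
    _ ≤ _ := by
        rw [lintegral_const_mul _ (by fun_prop)]
        grw [hC]
        rw [ENNReal.coe_mul, ENNReal.coe_rpow_of_nonneg _ (by linarith), mul_assoc]

/-! ### The seminorms as integrals of `Lᵖ` norms of differences -/

lemma ofReal_norm_rpow_div {p e r : ℝ} (hp : 0 ≤ p) (hr : 0 ≤ r) (z : ℂ) :
    ENNReal.ofReal (‖z‖ ^ p / r ^ e) = ENNReal.ofReal (r ^ (-e)) * ‖z‖ₑ ^ p := by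
  rw [div_eq_mul_inv, mul_comm, ← Real.rpow_neg hr, ENNReal.ofReal_mul (by positivity),
    ← ENNReal.ofReal_rpow_of_nonneg (norm_nonneg _) hp, ofReal_norm]

lemma lintegral_T_eq {p : ℝ} (hp : 1 ≤ p) (e : ℝ) (g : 𝓢(Rn1 n, ℂ)) :
    ∫⁻ X : Rn n, ∫⁻ t : ℝ, ∫⁻ s : ℝ, ENNReal.ofReal (‖g (X, t) - g (X, s)‖ ^ p / |t - s| ^ e) =
      ∫⁻ h : ℝ, ENNReal.ofReal (|h| ^ (-e)) * pNorm p (dif (0, h) g) ^ p := by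
  have hg := g.continuous
  have hm : Measurable fun z : Rn1 n × ℝ =>
      ENNReal.ofReal (|z.2| ^ (-e)) * ‖g (z.1 + (0, z.2)) - g z.1‖ₑ ^ p := by
    have : Measurable fun z : Rn1 n × ℝ => g (z.1 + (0, z.2)) - g z.1 :=
      Continuous.measurable (by fun_prop)
    fun_prop
  calc _ = ∫⁻ X : Rn n, ∫⁻ t : ℝ, ∫⁻ h : ℝ,
        ENNReal.ofReal (|h| ^ (-e)) * ‖g ((X, t) + (0, h)) - g (X, t)‖ₑ ^ p := by
        refine lintegral_congr fun X => lintegral_congr fun t => ?_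
        rw [← lintegral_add_left_eq_self _ t]
        refine lintegral_congr fun h => ?_
        rw [ofReal_norm_rpow_div (by linarith) (abs_nonneg _), sub_add_cancel_left, abs_neg,
          enorm_sub_rev, Prod.mk_add_mk, add_zero]
    _ = ∫⁻ x : Rn1 n, ∫⁻ h : ℝ,
        ENNReal.ofReal (|h| ^ (-e)) * ‖g (x + (0, h)) - g x‖ₑ ^ p := by
        rw [Measure.volume_eq_prod, lintegral_prod _ hm.lintegral_prod_right'.aemeasurable]
    _ = _ := by
        rw [lintegral_lintegral_swap hm.aemeasurable]
        refine lintegral_congr fun h => ?_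
        rw [lintegral_const_mul _ (by
          have : Continuous fun x => g (x + (0, h)) - g x := by fun_prop
          exact this.measurable.enorm.pow_const p), pNorm, eLpNorm_rpow_eq_ip hp, ip]
        simp only [dif_apply]

lemma lintegral_X_eq {p : ℝ} (hp : 1 ≤ p) (e : ℝ) (g : 𝓢(Rn1 n, ℂ)) :
    ∫⁻ t : ℝ, ∫⁻ X : Rn n, ∫⁻ Y : Rn n,
      ENNReal.ofReal (‖g (X + Y, t) - 2 * g (X, t) + g (X - Y, t)‖ ^ p / ‖Y‖ ^ e) =
      ∫⁻ Y : Rn n, ENNReal.ofReal (‖Y‖ ^ (-e)) * pNorm p (dif2 (Y, 0) g) ^ p := by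
  have hg := g.continuous
  have hm : Measurable fun z : Rn1 n × Rn n =>
      ENNReal.ofReal (‖z.2‖ ^ (-e)) *
        ‖g (z.1 + (z.2, 0)) - 2 * g z.1 + g (z.1 - (z.2, 0))‖ₑ ^ p := by
    have : Measurable fun z : Rn1 n × Rn n =>
        g (z.1 + (z.2, 0)) - 2 * g z.1 + g (z.1 - (z.2, 0)) :=
      Continuous.measurable (by fun_prop)
    fun_prop
  calc _ = ∫⁻ t : ℝ, ∫⁻ X : Rn n, ∫⁻ Y : Rn n, ENNReal.ofReal (‖Y‖ ^ (-e)) *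
          ‖g ((X, t) + (Y, 0)) - 2 * g (X, t) + g ((X, t) - (Y, 0))‖ₑ ^ p := by
        refine lintegral_congr fun X => lintegral_congr fun t => lintegral_congr fun Y => ?_
        rw [ofReal_norm_rpow_div (by linarith) (norm_nonneg _), Prod.mk_add_mk, Prod.mk_sub_mk,
          add_zero, sub_zero]
    _ = ∫⁻ x : Rn1 n, ∫⁻ Y : Rn n, ENNReal.ofReal (‖Y‖ ^ (-e)) *
          ‖g (x + (Y, 0)) - 2 * g x + g (x - (Y, 0))‖ₑ ^ p := by
        rw [Measure.volume_eq_prod, lintegral_prod_symm _ hm.lintegral_prod_right'.aemeasurable]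
    _ = _ := by
        rw [lintegral_lintegral_swap hm.aemeasurable]
        refine lintegral_congr fun Y => ?_
        rw [lintegral_const_mul _ (by
          have : Continuous fun x => g (x + (Y, 0)) - 2 * g x + g (x - (Y, 0)) := by fun_prop
          exact this.measurable.enorm.pow_const p), pNorm, eLpNorm_rpow_eq_ip hp, ip]
        simp only [dif2_apply]

/-! ### Gaussian averages -/

lemma exists_tsum_gaussian_le {Λ c : ℝ} (hΛ : 1 < Λ) (hc : 0 < c) :
    ∃ C : ℝ≥0, ∀ r : ℝ, 0 < r →
      ∑' j : ℕ, ENNReal.ofReal ((Λ ^ (j + 1)) ^ c * Real.exp (-π * (Λ ^ (j + 1) * r) ^ 2)) ≤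
        C * ENNReal.ofReal (r ^ (-c)) := by
  have hΛ0 : 0 < Λ := by linarith
  have hexp : ∀ x : ℝ, Real.exp (-π * x ^ 2) ≤ 1 := fun x => by
    rw [Real.exp_le_one_iff]
    have := mul_nonneg Real.pi_pos.le (sq_nonneg x)
    linarith
  obtain ⟨C, hC⟩ := exists_tsum_scale_le hΛ hc (max 1 (Real.toNNReal (c ^ c)))
    (g := fun x => ENNReal.ofReal (x ^ c * Real.exp (-π * x ^ 2)))
    (fun x hx => by
      calc _ ≤ (1 : ℝ≥0∞) * ENNReal.ofReal (x ^ c) := by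
            rw [one_mul]
            exact ENNReal.ofReal_le_ofReal (mul_le_of_le_one_right (by positivity) (hexp x))
        _ ≤ _ := by gcongr; simp)
    (fun x hx => by
      have h1 : x ^ c * x ^ c ≤ c ^ c * Real.exp (π * x ^ 2) := by
        have h2 : x ^ 2 / c ≤ Real.exp (x ^ 2 / c) := by
          linarith [Real.add_one_le_exp (x ^ 2 / c)]
        have h3 : (x ^ 2 / c) ^ c ≤ Real.exp (x ^ 2) := by
          calc _ ≤ (Real.exp (x ^ 2 / c)) ^ c := Real.rpow_le_rpow (by positivity) h2 hc.le
            _ = _ := by rw [← Real.exp_mul]; congr 1; field_simp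
        rw [Real.div_rpow (by positivity) hc.le, div_le_iff₀ (by positivity)] at h3
        calc x ^ c * x ^ c = (x ^ 2) ^ c := by rw [← Real.mul_rpow hx.le hx.le, sq]
          _ ≤ c ^ c * Real.exp (x ^ 2) := by linarith
          _ ≤ _ := by
            gcongr
            have := Real.pi_gt_three
            nlinarith [sq_nonneg x]
      calc _ ≤ ENNReal.ofReal (c ^ c) * ENNReal.ofReal (x ^ (-c)) := by
            rw [← ENNReal.ofReal_mul (by positivity)]
            refine ENNReal.ofReal_le_ofReal ?_
            rw [Real.rpow_neg hx.le, ← div_eq_mul_inv, le_div_iff₀ (by positivity), neg_mul,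
              Real.exp_neg, mul_assoc, mul_comm _ (x ^ c), ← mul_assoc, ← div_eq_mul_inv,
              div_le_iff₀ (by positivity)]
            exact h1
        _ ≤ _ := by
            gcongr
            rw [ENNReal.ofReal, ENNReal.coe_le_coe]
            exact le_max_right _ _)
  refine ⟨C, fun r hr => ?_⟩
  grw [← hC (Λ * r) (by positivity), ← ENNReal.tsum_mul_right]
  refine ENNReal.tsum_le_tsum fun j => ?_
  rw [← ENNReal.ofReal_mul (by positivity), ← mul_assoc (Λ ^ j), ← pow_succ]
  apply le_of_eq
  congr 1
  rw [Real.mul_rpow (by positivity) hr.le, Real.rpow_neg hr.le]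
  field_simp

section average

variable {V : Type*} [NormedAddCommGroup V] [InnerProductSpace ℝ V] [FiniteDimensional ℝ V]
  [MeasurableSpace V] [BorelSpace V]

lemma exists_tsum_lintegral_gaussian_le {Λ e : ℝ} (hΛ : 1 < Λ) (he : 0 < e) :
    ∃ C : ℝ≥0, ∀ F : V → ℝ≥0∞, Measurable F → F 0 = 0 →
      ∑' j : ℕ, ENNReal.ofReal ((Λ ^ (j + 1)) ^ e) *
        ∫⁻ Y : V, ENNReal.ofReal (Real.exp (-π * ‖Y‖ ^ 2)) * F ((Λ ^ (j + 1))⁻¹ • Y) ≤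
      C * ∫⁻ Y : V, ENNReal.ofReal (‖Y‖ ^ (-(Module.finrank ℝ V + e))) * F Y := by
  obtain ⟨C, hC⟩ := exists_tsum_gaussian_le (c := Module.finrank ℝ V + e) hΛ (by positivity)
  have hΛ0 : 0 < Λ := by linarith
  refine ⟨C, fun F hF hF0 => ?_⟩
  calc _ = ∑' j : ℕ, ∫⁻ Y : V, ENNReal.ofReal ((Λ ^ (j + 1)) ^ (Module.finrank ℝ V + e) *
        Real.exp (-π * (Λ ^ (j + 1) * ‖Y‖) ^ 2)) * F Y := by
        refine tsum_congr fun j => ?_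
        have hl : 0 < Λ ^ (j + 1) := by positivity
        rw [← lintegral_comp_dilate hl (F := fun Y : V =>
          ENNReal.ofReal (Real.exp (-π * ‖Y‖ ^ 2)) * F ((Λ ^ (j + 1))⁻¹ • Y)) (by fun_prop),
          ← lintegral_const_mul _ (by fun_prop)]
        refine lintegral_congr fun Y => ?_
        rw [smul_smul, inv_mul_cancel₀ hl.ne', one_smul, norm_smul, Real.norm_of_nonneg hl.le,
          Real.rpow_add hl, Real.rpow_natCast, ENNReal.ofReal_mul (by positivity),
          ENNReal.ofReal_mul (by positivity)]
        ring
    _ = ∫⁻ Y : V, ∑' j : ℕ, ENNReal.ofReal ((Λ ^ (j + 1)) ^ (Module.finrank ℝ V + e) *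
        Real.exp (-π * (Λ ^ (j + 1) * ‖Y‖) ^ 2)) * F Y := by
        rw [lintegral_tsum fun j => by fun_prop]
    _ ≤ ∫⁻ Y : V, C * (ENNReal.ofReal (‖Y‖ ^ (-(Module.finrank ℝ V + e))) * F Y) := by
        refine lintegral_mono fun Y => ?_
        rw [ENNReal.tsum_mul_right]
        rcases eq_or_ne Y 0 with rfl | hY
        · simp [hF0]
        · rw [← mul_assoc]
          gcongr
          exact hC _ (norm_pos_iff.2 hY)
    _ = _ := lintegral_const_mul _ (by fun_prop)

lemma integral_gaussian_mul_cexp (z : V) :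
    ∫ Y : V, ((Real.exp (-π * ‖Y‖ ^ 2) : ℝ) : ℂ) *
      Complex.exp (2 * π * Complex.I * ((inner ℝ z Y : ℝ) : ℂ)) =
      ((Real.exp (-π * ‖z‖ ^ 2) : ℝ) : ℂ) := by
  have h := GaussianFourier.integral_cexp_neg_mul_sq_norm_add (V := V) (b := (π : ℂ))
    (by simpa using Real.pi_pos) (2 * π * Complex.I) z
  rw [div_self (by simp [Real.pi_ne_zero]), Complex.one_cpow, one_mul] at h
  have h2 : ((Real.exp (-π * ‖z‖ ^ 2) : ℝ) : ℂ) =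
      Complex.exp ((2 * π * Complex.I) ^ 2 * ‖z‖ ^ 2 / (4 * π)) := by
    rw [Complex.ofReal_exp]
    congr 1
    have : (π : ℂ) ≠ 0 := by simp [Real.pi_ne_zero]
    push_cast
    field_simp
    rw [Complex.I_sq]
    ring
  rw [h2, ← h]
  refine integral_congr_ae (.of_forall fun Y => ?_)
  simp only [Complex.ofReal_exp, ← Complex.exp_add]
  push_cast
  rfl

lemma integrable_gaussian :
    Integrable fun Y : V => ((Real.exp (-π * ‖Y‖ ^ 2) : ℝ) : ℂ) := by
  have h := GaussianFourier.integrable_cexp_neg_mul_sq_norm_add (V := V) (b := (π : ℂ))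
    (by simpa using Real.pi_pos) (0 : ℂ) (0 : V)
  refine h.congr (.of_forall fun Y => ?_)
  simp [Complex.ofReal_exp]

lemma lintegral_gaussian_lt_top :
    ∫⁻ Y : V, ENNReal.ofReal (Real.exp (-π * ‖Y‖ ^ 2)) < ⊤ := by
  refine (lintegral_congr fun Y => ?_).trans_lt (integrable_gaussian (V := V)).2
  rw [← ofReal_norm, Complex.norm_real, Real.norm_of_nonneg (by positivity)]

/-- The pairing `x·q` on `ℝⁿ × ℝ`. -/
def dot (x q : Rn1 n) : ℝ := (∑ k, x.1 k * q.1 k) + x.2 * q.2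

lemma continuous_dot : Continuous fun z : Rn1 n × Rn1 n => dot z.1 z.2 := by
  unfold dot; fun_prop

lemma fs_sh (v : Rn1 n) (u : 𝓢(Rn1 n, ℂ)) (q : Rn1 n) :
    fs (sh v u) q = Complex.exp (2 * π * Complex.I * (dot v q : ℂ)) * fs u q := by
  rw [fs_apply, fs_apply, FT1, FT1, ← integral_const_mul,
    ← integral_add_right_eq_self (μ := volume) (fun x => _ * (_ * u x)) v]
  refine integral_congr_ae (.of_forall fun x => ?_)
  simp only [sh_apply]
  rw [← mul_assoc, ← Complex.exp_add]
  congr 2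
  simp only [dot, Prod.fst_add, Prod.snd_add, PiLp.add_apply, add_mul, Finset.sum_add_distrib]
  push_cast
  ring

lemma fs_dif (v : Rn1 n) (u : 𝓢(Rn1 n, ℂ)) (q : Rn1 n) :
    fs (dif v u) q = (Complex.exp (2 * π * Complex.I * (dot v q : ℂ)) - 1) * fs u q := by
  rw [dif_eq, sub_eq_add_neg, ← neg_one_smul ℂ u, fs_add, fs_smul, add_apply, smul_apply, fs_sh,
    smul_eq_mul]
  ring

lemma fs_dif2 (v : Rn1 n) (u : 𝓢(Rn1 n, ℂ)) (q : Rn1 n) :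
    fs (dif2 v u) q = (Complex.exp (2 * π * Complex.I * (dot v q : ℂ)) - 2 +
      Complex.exp (2 * π * Complex.I * (dot (-v) q : ℂ))) * fs u q := by
  have h : Complex.exp (2 * π * Complex.I * (dot v q : ℂ)) *
      Complex.exp (2 * π * Complex.I * (dot (-v) q : ℂ)) = 1 := by
    rw [← Complex.exp_add, Complex.exp_eq_one_iff]
    exact ⟨0, by simp [dot]; ring⟩
  rw [dif2_eq, fs_sh, fs_dif, fs_dif]
  linear_combination (fs u q * (Complex.exp (2 * π * Complex.I * (dot v q : ℂ)) - 2)) * h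

lemma integral_family_eq_IFT1 {w : V → ℂ} (hw : Integrable w) (U : V → 𝓢(Rn1 n, ℂ))
    (u : 𝓢(Rn1 n, ℂ)) {κ : V → Rn1 n → ℂ} (hκ : Continuous fun z : V × Rn1 n => κ z.1 z.2)
    {B : ℝ} (hB : ∀ Y q, ‖κ Y q‖ ≤ B) (hU : ∀ Y q, fs (U Y) q = κ Y q * fs u q) (x : Rn1 n) :
    ∫ Y : V, w Y * U Y x = IFT1 (fun q => (∫ Y : V, w Y * κ Y q) * fs u q) x := by
  set E : Rn1 n → ℂ := fun q => Complex.exp ((2 * (π : ℂ) * Complex.I) *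
      (((∑ k, q.1 k * x.1 k) + q.2 * x.2 : ℝ) : ℂ)) with hE
  have hEc : Continuous E := by rw [hE]; fun_prop
  have hEn : ∀ q, ‖E q‖ = 1 := by
    intro q
    rw [hE]
    simp only
    rw [mul_right_comm, mul_comm, mul_comm (2 * (π : ℂ)), ← Complex.ofReal_ofNat,
      ← Complex.ofReal_mul, ← Complex.ofReal_mul, mul_comm]
    exact Complex.norm_exp_ofReal_mul_I _
  have hint : Integrable (Function.uncurry fun (Y : V) (q : Rn1 n) =>
      w Y * (E q * (κ Y q * fs u q))) (volume.prod volume) := by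
    have h1 : Integrable (fun z : V × Rn1 n => w z.1 * fs u z.2) (volume.prod volume) :=
      hw.mul_prod (fs u).integrable
    have h2 := h1.bdd_mul (f := fun z : V × Rn1 n => E z.2 * κ z.1 z.2) (c := B)
      ((hEc.comp continuous_snd).mul hκ).aestronglyMeasurable
      (.of_forall fun z => by rw [norm_mul, hEn, one_mul]; exact hB _ _)
    refine h2.congr (.of_forall fun z => ?_)
    simp only [Function.uncurry]
    ring
  have h1 : ∀ Y, w Y * U Y x = ∫ q, w Y * (E q * (κ Y q * fs u q)) := by
    intro Y
    rw [integral_const_mul, ← fsi_fs (U Y), fsi_apply, IFT1]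
    simp only [hU]
    rfl
  simp only [h1]
  rw [integral_integral_swap hint, IFT1]
  refine integral_congr_ae (.of_forall fun q => ?_)
  simp only
  rw [← integral_mul_const, ← integral_const_mul]
  refine integral_congr_ae (.of_forall fun Y => ?_)
  simp only [hE]
  ring

lemma norm_cexp_dot (v q : Rn1 n) : ‖Complex.exp (2 * π * Complex.I * (dot v q : ℂ))‖ = 1 := by
  rw [mul_right_comm, ← Complex.ofReal_ofNat, ← Complex.ofReal_mul, ← Complex.ofReal_mul]
  exact Complex.norm_exp_ofReal_mul_I _

lemma integrable_gaussian_mul_cexp {v : V → Rn1 n} (hv : Continuous v) (q : Rn1 n) :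
    Integrable fun Y : V => ((Real.exp (-π * ‖Y‖ ^ 2) : ℝ) : ℂ) *
      Complex.exp (2 * π * Complex.I * (dot (v Y) q : ℂ)) := by
  have hc : Continuous fun Y => dot (v Y) q := continuous_dot.comp (hv.prodMk continuous_const)
  have := integrable_gaussian.bdd_mul (f := fun Y : V =>
    Complex.exp (2 * π * Complex.I * (dot (v Y) q : ℂ))) (c := 1)
    (Continuous.aestronglyMeasurable (by fun_prop)) (.of_forall fun Y => (norm_cexp_dot _ _).le)
  simpa only [mul_comm] using this

lemma integral_gaussian_dif {v : V → Rn1 n} (hv : Continuous v) {z : Rn1 n → V}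
    (hz : ∀ Y q, dot (v Y) q = inner ℝ (z q) Y) (u : 𝓢(Rn1 n, ℂ)) (x : Rn1 n) :
    ∫ Y : V, ((Real.exp (-π * ‖Y‖ ^ 2) : ℝ) : ℂ) * dif (v Y) u x =
      IFT1 (fun q => (((Real.exp (-π * ‖z q‖ ^ 2) : ℝ) : ℂ) - 1) * fs u q) x := by
  have hc : Continuous fun z : V × Rn1 n => dot (v z.1) z.2 :=
    continuous_dot.comp ((hv.comp continuous_fst).prodMk continuous_snd)
  rw [integral_family_eq_IFT1 integrable_gaussian (fun Y => dif (v Y) u) u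
    (κ := fun Y q => Complex.exp (2 * π * Complex.I * (dot (v Y) q : ℂ)) - 1) (by fun_prop)
    (B := 2) (fun Y q => (norm_sub_le _ _).trans (by rw [norm_cexp_dot]; norm_num))
    (fun Y q => fs_dif _ _ _)]
  congr 1
  ext q
  congr 1
  simp only [mul_sub]
  rw [integral_sub (integrable_gaussian_mul_cexp hv q) (by simpa using integrable_gaussian)]
  simp only [hz]
  rw [integral_gaussian_mul_cexp]
  congr 1
  simpa using integral_gaussian_mul_cexp (0 : V)

lemma integral_gaussian_dif2 {v : V → Rn1 n} (hv : Continuous v) {z : Rn1 n → V}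
    (hz : ∀ Y q, dot (v Y) q = inner ℝ (z q) Y) (u : 𝓢(Rn1 n, ℂ)) (x : Rn1 n) :
    ∫ Y : V, ((Real.exp (-π * ‖Y‖ ^ 2) : ℝ) : ℂ) * dif2 (v Y) u x =
      IFT1 (fun q => (2 * (((Real.exp (-π * ‖z q‖ ^ 2) : ℝ) : ℂ) - 1)) * fs u q) x := by
  have hc : Continuous fun z : V × Rn1 n => dot (v z.1) z.2 :=
    continuous_dot.comp ((hv.comp continuous_fst).prodMk continuous_snd)
  have hc' : Continuous fun z : V × Rn1 n => dot (-v z.1) z.2 :=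
    continuous_dot.comp ((hv.comp continuous_fst).neg.prodMk continuous_snd)
  rw [integral_family_eq_IFT1 integrable_gaussian (fun Y => dif2 (v Y) u) u
    (κ := fun Y q => Complex.exp (2 * π * Complex.I * (dot (v Y) q : ℂ)) - 2 +
      Complex.exp (2 * π * Complex.I * (dot (-v Y) q : ℂ))) (by fun_prop)
    (B := 4) (fun Y q => by
      grw [norm_add_le, norm_sub_le]
      rw [norm_cexp_dot, norm_cexp_dot]
      norm_num)
    (fun Y q => fs_dif2 _ _ _)]
  congr 1
  ext q
  congr 1
  have hz' : ∀ Y, dot (-v Y) q = inner ℝ (-z q) Y := by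
    intro Y
    rw [inner_neg_left, ← hz]
    simp [dot]
    ring
  have h2 : Integrable fun Y : V => ((Real.exp (-π * ‖Y‖ ^ 2) : ℝ) : ℂ) * 2 :=
    integrable_gaussian.mul_const 2
  have h4 : Integrable fun Y : V => ((Real.exp (-π * ‖Y‖ ^ 2) : ℝ) : ℂ) *
      Complex.exp (2 * π * Complex.I * (dot (v Y) q : ℂ)) -
      ((Real.exp (-π * ‖Y‖ ^ 2) : ℝ) : ℂ) * 2 := (integrable_gaussian_mul_cexp hv q).sub h2
  have h5 : Integrable fun Y : V => ((Real.exp (-π * ‖Y‖ ^ 2) : ℝ) : ℂ) *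
      Complex.exp (2 * π * Complex.I * (dot (-v Y) q : ℂ)) :=
    integrable_gaussian_mul_cexp hv.neg q
  simp only [mul_add, mul_sub]
  rw [integral_add h4 h5, integral_sub (integrable_gaussian_mul_cexp hv q) h2]
  have h3 : ∫ Y : V, ((Real.exp (-π * ‖Y‖ ^ 2) : ℝ) : ℂ) = 1 := by
    simpa using integral_gaussian_mul_cexp (0 : V)
  simp only [hz, hz']
  rw [integral_gaussian_mul_cexp, integral_gaussian_mul_cexp, norm_neg, integral_mul_const, h3]
  ring

end average

/-! ### Lower bounds for the differences -/

lemma contDiff_dsym (β : Fin n → ℕ) (l : ℕ) : ContDiff ℝ ∞ (dsym β l : Rn1 n → ℂ) := by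
  have h : ContDiff ℝ ∞ fun x : ℝ => (x : ℂ) := Complex.ofRealCLM.contDiff
  have h1 : ∀ k : Fin n, ContDiff ℝ ∞ fun q : Rn1 n => (q.1 k : ℂ) := fun k =>
    h.comp ((EuclideanSpace.proj (𝕜 := ℝ) k).contDiff.comp contDiff_fst)
  have h2 : ContDiff ℝ ∞ fun q : Rn1 n => (q.2 : ℂ) := h.comp contDiff_snd
  unfold dsym
  exact (contDiff_prod fun k _ => (contDiff_const.mul (h1 k)).pow _).mul
    ((contDiff_const.mul h2).pow _)

/-- The defect `e^{-π|z|²} - 1` of the Gaussian. -/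
def gdef {V : Type*} [NormedAddCommGroup V] (z : V) : ℂ :=
  ((Real.exp (-π * ‖z‖ ^ 2) : ℝ) : ℂ) - 1

lemma contDiff_gdef {V : Type*} [NormedAddCommGroup V] [InnerProductSpace ℝ V] :
    ContDiff ℝ ∞ (gdef : V → ℂ) :=
  (Complex.ofRealCLM.contDiff.comp (Real.contDiff_exp.comp
    (contDiff_const.mul (contDiff_norm_sq ℝ)))).sub contDiff_const

lemma gdef_ne_zero {V : Type*} [NormedAddCommGroup V] {z : V} (hz : z ≠ 0) : gdef z ≠ 0 := by
  rw [gdef, sub_ne_zero, ← Complex.ofReal_one, Ne, Complex.ofReal_inj, Real.exp_eq_one_iff]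
  have := norm_pos_iff.2 hz
  have := Real.pi_pos
  have : 0 < π * ‖z‖ ^ 2 := by positivity
  linarith

lemma norm_gdef_le {V : Type*} [NormedAddCommGroup V] (z : V) : ‖gdef z‖ ≤ 2 := by
  have h : Real.exp (-π * ‖z‖ ^ 2) ≤ 1 := by
    rw [Real.exp_le_one_iff]
    have := mul_nonneg Real.pi_pos.le (sq_nonneg ‖z‖)
    linarith
  rw [gdef]
  grw [norm_sub_le]
  rw [Complex.norm_real, Real.norm_of_nonneg (by positivity), norm_one]
  linarith

/-- The symbols whose common zero set is the origin: `(2πiξ_k)^{2i}·2(e^{-π|ξ|²} - 1)` and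
`(2πiτ)^i·(e^{-πτ²} - 1)`. -/
def osym (i : ℕ) : Option (Fin n) → Rn1 n → ℂ
  | some k => fun q => dsym (Pi.single k (2 * i)) 0 q * (2 * gdef q.1)
  | none => fun q => dsym 0 i q * gdef q.2

lemma contDiff_osym (i : ℕ) (o : Option (Fin n)) : ContDiff ℝ ∞ (osym i o : Rn1 n → ℂ) := by
  cases o with
  | none => exact (contDiff_dsym _ _).mul (contDiff_gdef.comp contDiff_snd)
  | some k => exact (contDiff_dsym _ _).mul (contDiff_const.mul (contDiff_gdef.comp contDiff_fst))

lemma exists_osym_ne_zero (i : ℕ) {q : Rn1 n} (hq : q ≠ 0) : ∃ o, osym i o q ≠ 0 := by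
  have h0 : (2 * π * Complex.I : ℂ) ≠ 0 := by simp [Real.pi_ne_zero]
  by_cases h : q.2 = 0
  · have h1 : q.1 ≠ 0 := fun h1 => hq (Prod.ext h1 h)
    obtain ⟨k, hk⟩ : ∃ k, q.1 k ≠ 0 := by
      by_contra! h2
      exact h1 (by ext k; simpa using h2 k)
    refine ⟨some k, mul_ne_zero ?_ (mul_ne_zero two_ne_zero (gdef_ne_zero h1))⟩
    rw [dsym, pow_zero, mul_one, Finset.prod_eq_single k]
    · exact pow_ne_zero _ (mul_ne_zero h0 (by simpa using hk))
    · intro l _ hl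
      simp [hl]
    · simp
  · refine ⟨none, mul_ne_zero ?_ (gdef_ne_zero h)⟩
    simp [dsym, h, Real.pi_ne_zero]

lemma ParabolicLP.hasCompactSupport_fs_phi (P : ParabolicLP n) : HasCompactSupport (fs P.φ) := by
  refine HasCompactSupport.of_support_subset_isCompact (isCompact_closedBall (0 : Rn1 n) 4)
    fun q hq => ?_
  have h : rho q < 2 := by
    by_contra! h
    exact hq (P.fs_phi_eq_zero (Or.inr h))
  have h1 : 0 ≤ |q.2| ^ ((1 : ℝ) / 2) := by positivity
  have h2 := norm_nonneg q.1
  have h3 : |q.2| ^ ((1 : ℝ) / 2) < 2 := by unfold rho at h; linarith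
  have h4 : ‖q.1‖ < 2 := by unfold rho at h; linarith
  rw [← Real.sqrt_eq_rpow, Real.sqrt_lt' (by norm_num)] at h3
  rw [mem_closedBall_zero_iff, Prod.norm_def, Real.norm_eq_abs]
  exact max_le (by linarith) (by linarith)

lemma ParabolicLP.exists_sum_fs_mul_eq (P : ParabolicLP n) {ι : Type*} [Fintype ι]
    (s : ι → Rn1 n → ℂ) (hs : ∀ o, ContDiff ℝ ∞ (s o)) (h0 : ∀ q ≠ 0, ∃ o, s o q ≠ 0) :
    ∃ K : ι → 𝓢(Rn1 n, ℂ), ∀ q, ∑ o, fs (K o) q * s o q = fs P.φ q := by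
  set M : Rn1 n → ℂ := fun q => ∑ o, s o q * (starRingEnd ℂ) (s o q) with hM
  have hconj : ∀ o, ContDiff ℝ ∞ fun q => (starRingEnd ℂ) (s o q) := fun o =>
    Complex.conjCLE.contDiff.comp (hs o)
  have hMc : ContDiff ℝ ∞ M := ContDiff.sum fun o _ => (hs o).mul (hconj o)
  have hM0 : ∀ q ≠ 0, M q ≠ 0 := by
    intro q hq
    obtain ⟨o, ho⟩ := h0 q hq
    have h1 : M q = ((∑ o, Complex.normSq (s o q) : ℝ) : ℂ) := by
      simp [hM, Complex.mul_conj]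
    rw [h1, Complex.ofReal_ne_zero]
    exact (Finset.sum_pos' (f := fun o => Complex.normSq (s o q)) (fun o _ => Complex.normSq_nonneg _)
      ⟨o, Finset.mem_univ _, Complex.normSq_pos.2 ho⟩).ne'
  have hK : ∀ o, ContDiff ℝ ∞ fun q => fs P.φ q * ((starRingEnd ℂ) (s o q) * (M q)⁻¹) := by
    intro o
    rw [contDiff_iff_contDiffAt]
    intro q
    rcases eq_or_ne q 0 with rfl | hq
    · have h1 : ∀ᶠ q in nhds (0 : Rn1 n), rho q < 1 / 2 :=
        continuous_rho.continuousAt.eventually_lt continuousAt_const (by norm_num [rho])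
      refine (contDiffAt_const (c := (0 : ℂ))).congr_of_eventuallyEq ?_
      filter_upwards [h1] with q hq
      rw [P.fs_phi_eq_zero (Or.inl hq.le), zero_mul]
    · exact ((fs P.φ).smooth _).contDiffAt.mul ((hconj o).contDiffAt.mul
        (hMc.contDiffAt.inv (hM0 q hq)))
  refine ⟨fun o => fsi ((P.hasCompactSupport_fs_phi.mul_right (f' := fun q =>
    (starRingEnd ℂ) (s o q) * (M q)⁻¹)).toSchwartzMap (hK o)), fun q => ?_⟩
  simp only [fs_fsi]
  change ∑ o, fs P.φ q * ((starRingEnd ℂ) (s o q) * (M q)⁻¹) * s o q = _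
  rcases eq_or_ne q 0 with rfl | hq
  · simp [P.fs_phi_eq_zero (q := 0) (Or.inl (by norm_num [rho]))]
  · have h1 : ∀ o, fs P.φ q * ((starRingEnd ℂ) (s o q) * (M q)⁻¹) * s o q =
        fs P.φ q * (M q)⁻¹ * (s o q * (starRingEnd ℂ) (s o q)) := fun o => by ring
    simp only [h1, ← Finset.mul_sum]
    exact inv_mul_cancel_right₀ (hM0 q hq) _

/-- The Gaussian factor of `osym`. -/
def gsym : Option (Fin n) → Rn1 n → ℂ
  | some _ => fun q => 2 * gdef q.1
  | none => fun q => gdef q.2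

/-- The top order derivatives `D_{X_k}^{2i}` and `D_t^i`. -/
def oD (i : ℕ) : Option (Fin n) → 𝓢(Rn1 n, ℂ) → 𝓢(Rn1 n, ℂ)
  | some k => sD (Pi.single k (2 * i)) 0
  | none => sD 0 i

lemma osym_dsc_mul_fs (i : ℕ) (o : Option (Fin n)) (a : ℝ) (f : 𝓢(Rn1 n, ℂ)) (q : Rn1 n) :
    osym i o (dsc a q) * fs f q = (a : ℂ) ^ (2 * i) * (gsym o (dsc a q) * fs (oD i o f) q) := by
  cases o with
  | none =>
    simp only [osym, gsym, oD, dsym_dsc, fs_sD, Pi.zero_apply, Finset.sum_const_zero, zero_add]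
    ring
  | some k =>
    simp only [osym, gsym, oD, dsym_dsc, fs_sD, Finset.sum_pi_single', Finset.mem_univ, if_true,
      mul_zero, add_zero]
    ring

lemma continuous_gsym (o : Option (Fin n)) : Continuous (gsym o : Rn1 n → ℂ) := by
  cases o with
  | none => exact contDiff_gdef.continuous.comp continuous_snd
  | some k => exact continuous_const.mul (contDiff_gdef.continuous.comp continuous_fst)

lemma norm_gsym_le (o : Option (Fin n)) (q : Rn1 n) : ‖gsym o q‖ ≤ 4 := by
  cases o with
  | none => exact (norm_gdef_le _).trans (by norm_num)
  | some k =>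
    rw [gsym, norm_mul, Complex.norm_two]
    linarith [norm_gdef_le q.1]

lemma continuous_dsc (a : ℝ) : Continuous (dsc a : Rn1 n → Rn1 n) := by
  unfold dsc; fun_prop

lemma IFT1_const_mul (c : ℂ) (g : Rn1 n → ℂ) (x : Rn1 n) :
    IFT1 (fun q => c * g q) x = c * IFT1 g x := by
  rw [IFT1, IFT1, ← integral_const_mul]
  exact integral_congr_ae (.of_forall fun q => by ring)

lemma IFT1_sum_mul_fs {ι : Type*} (s : Finset ι) {g : ι → Rn1 n → ℂ} (hg : ∀ o, Continuous (g o))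
    {B : ℝ} (hB : ∀ o q, ‖g o q‖ ≤ B) (u : ι → 𝓢(Rn1 n, ℂ)) (x : Rn1 n) :
    IFT1 (fun q => ∑ o ∈ s, g o q * fs (u o) q) x =
      ∑ o ∈ s, IFT1 (fun q => g o q * fs (u o) q) x := by
  simp only [IFT1, Finset.mul_sum]
  refine integral_finsetSum _ fun o _ => ?_
  have h1 := (fs (u o)).integrable (μ := volume).bdd_mul (f := fun q => Complex.exp
    ((2 * (π : ℂ) * Complex.I) * (((∑ k, q.1 k * x.1 k) + q.2 * x.2 : ℝ) : ℂ)) * g o q) (c := B)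
    (Continuous.aestronglyMeasurable (by have := hg o; fun_prop)) (.of_forall fun q => by
      rw [norm_mul, mul_right_comm, ← Complex.ofReal_ofNat, ← Complex.ofReal_mul,
        ← Complex.ofReal_mul, Complex.norm_exp_ofReal_mul_I, one_mul]
      exact hB o q)
  exact h1.congr (.of_forall fun q => by ring)

lemma ParabolicLP.cv_blk_succ_apply (P : ParabolicLP n) {i : ℕ} {K : Option (Fin n) → 𝓢(Rn1 n, ℂ)}
    (hK : ∀ q, ∑ o, fs (K o) q * osym i o q = fs P.φ q) (j : ℕ) (f : 𝓢(Rn1 n, ℂ)) (x : Rn1 n) :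
    cv (P.blk (j + 1)) f x = (((2 ^ (j + 1))⁻¹ : ℝ) : ℂ) ^ (2 * i) *
      ((∫ h : ℝ, ((Real.exp (-π * ‖h‖ ^ 2) : ℝ) : ℂ) * dif ((0, ((4 : ℝ) ^ (j + 1))⁻¹ • h) : Rn1 n)
        (cv (dil (2 ^ (j + 1)) (by positivity) (K none)) (sD 0 i f)) x) +
      ∑ k, ∫ Y : Rn n, ((Real.exp (-π * ‖Y‖ ^ 2) : ℝ) : ℂ) *
        dif2 ((((2 : ℝ) ^ (j + 1))⁻¹ • Y, 0) : Rn1 n)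
        (cv (dil (2 ^ (j + 1)) (by positivity) (K (some k)))
          (sD (Pi.single k (2 * i)) 0 f)) x) := by
  have h4 : ((4 : ℝ) ^ (j + 1))⁻¹ = (((2 : ℝ) ^ (j + 1))⁻¹) ^ 2 := by
    rw [inv_pow, ← pow_mul, mul_comm, pow_mul]; norm_num
  set a : ℝ := (2 ^ (j + 1))⁻¹ with ha
  rw [integral_gaussian_dif (V := ℝ) (by fun_prop) (z := fun q => ((4 : ℝ) ^ (j + 1))⁻¹ * q.2)
    (fun Y q => by simp [dot]; ring)]
  have hX : ∀ u : 𝓢(Rn1 n, ℂ), ∫ Y : Rn n, ((Real.exp (-π * ‖Y‖ ^ 2) : ℝ) : ℂ) *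
      dif2 ((a • Y, 0) : Rn1 n) u x = IFT1 (fun q => (2 * gdef (a • q.1)) * fs u q) x := fun u =>
    integral_gaussian_dif2 (V := Rn n) (v := fun Y => ((a • Y, 0) : Rn1 n)) (by fun_prop)
      (z := fun q => a • q.1) (fun Y q => by
        simp only [dot, PiLp.smul_apply, smul_eq_mul, zero_mul, add_zero, PiLp.inner_apply,
          RCLike.inner_apply, conj_trivial]
        exact Finset.sum_congr rfl fun k _ => by ring) u x
  simp only [hX]
  have hm : ∀ (o : Option (Fin n)) q, fs (K o) (dsc a q) * (osym i o (dsc a q) * fs f q) =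
      (a : ℂ) ^ (2 * i) * (gsym o (dsc a q) *
        fs (cv (dil (2 ^ (j + 1)) (by positivity) (K o)) (oD i o f)) q) := by
    intro o q
    rw [osym_dsc_mul_fs, fs_cv, fs_dil (by positivity)]
    ring
  have h1 : ∀ q, fs (cv (P.blk (j + 1)) f) q = (a : ℂ) ^ (2 * i) * ∑ o, gsym o (dsc a q) *
      fs (cv (dil (2 ^ (j + 1)) (by positivity) (K o)) (oD i o f)) q := by
    intro q
    rw [fs_cv, P.fs_blk_succ, ← hK, Finset.sum_mul, Finset.mul_sum]
    refine Finset.sum_congr rfl fun o _ => ?_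
    rw [mul_assoc]
    exact hm o q
  rw [← fsi_fs (cv (P.blk (j + 1)) f), fsi_apply, show ⇑(fs (cv (P.blk (j + 1)) f)) = _ from
    funext h1, IFT1_const_mul, IFT1_sum_mul_fs Finset.univ (g := fun o q => gsym o (dsc a q))
    (fun o => (continuous_gsym o).comp (continuous_dsc a)) (fun o q => norm_gsym_le o _),
    Fintype.sum_option, h4]
  rfl

lemma pNorm_rpow_eq_ip {p : ℝ} (hp : 1 ≤ p) (g : 𝓢(Rn1 n, ℂ)) : pNorm p g ^ p = ip p g :=
  eLpNorm_rpow_eq_ip hp g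

lemma continuous_dif_apply (u : 𝓢(Rn1 n, ℂ)) :
    Continuous fun z : Rn1 n × Rn1 n => dif z.1 u z.2 := by
  have := u.continuous
  simp only [dif_apply]
  fun_prop

lemma continuous_dif2_apply (u : 𝓢(Rn1 n, ℂ)) :
    Continuous fun z : Rn1 n × Rn1 n => dif2 z.1 u z.2 := by
  have := u.continuous
  simp only [dif2_apply]
  fun_prop

lemma continuous_uncurry_apply {V : Type*} [TopologicalSpace V]
    {D : Rn1 n → 𝓢(Rn1 n, ℂ) → 𝓢(Rn1 n, ℂ)}
    (hD : ∀ u, Continuous fun z : Rn1 n × Rn1 n => D z.1 u z.2) {v : V → Rn1 n}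
    (hv : Continuous v) (u : 𝓢(Rn1 n, ℂ)) :
    Continuous (Function.uncurry fun Y : V => ⇑(D (v Y) u)) :=
  (hD u).comp ((hv.comp continuous_fst).prodMk continuous_snd)

section average

variable {V : Type*} [NormedAddCommGroup V] [InnerProductSpace ℝ V] [FiniteDimensional ℝ V]
  [MeasurableSpace V] [BorelSpace V]

/-- The Gaussian average of the absolute values of a family of functions. -/
def gavg (U : V → Rn1 n → ℂ) (x : Rn1 n) : ℝ≥0∞ :=
  ∫⁻ Y : V, ENNReal.ofReal (Real.exp (-π * ‖Y‖ ^ 2)) * ‖U Y x‖ₑ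

lemma enorm_integral_le_gavg (U : V → Rn1 n → ℂ) (x : Rn1 n) :
    ‖∫ Y : V, ((Real.exp (-π * ‖Y‖ ^ 2) : ℝ) : ℂ) * U Y x‖ₑ ≤ gavg U x := by
  refine (enorm_integral_le_lintegral_enorm _).trans (lintegral_mono fun Y => ?_)
  rw [enorm_mul, ← ofReal_norm, Complex.norm_real, Real.norm_of_nonneg (by positivity)]

lemma measurable_gavg {U : V → Rn1 n → ℂ} (hU : Continuous (Function.uncurry U)) :
    Measurable (gavg U) := by
  have h : Measurable fun z : Rn1 n × V =>
      ENNReal.ofReal (Real.exp (-π * ‖z.2‖ ^ 2)) * ‖U z.2 z.1‖ₑ :=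
    .mul (by fun_prop) (hU.comp continuous_swap).measurable.enorm
  exact h.lintegral_prod_right'

lemma lintegral_gavg_rpow_le {p : ℝ} (hp : 1 ≤ p) {U : V → Rn1 n → ℂ}
    (hU : Continuous (Function.uncurry U)) :
    ∫⁻ x, gavg U x ^ p ≤ (∫⁻ Y : V, ENNReal.ofReal (Real.exp (-π * ‖Y‖ ^ 2))) ^ (p - 1) *
      ∫⁻ Y : V, ENNReal.ofReal (Real.exp (-π * ‖Y‖ ^ 2)) * ip p (U Y) := by
  have hU1 : ∀ x, Continuous fun Y => U Y x := fun x => hU.comp (Continuous.prodMk_left x)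
  have hU2 : ∀ Y, Continuous (U Y) := fun Y => hU.comp (Continuous.prodMk_right Y)
  have hm : Measurable fun z : Rn1 n × V =>
      ENNReal.ofReal (Real.exp (-π * ‖z.2‖ ^ 2)) * ‖U z.2 z.1‖ₑ ^ p :=
    .mul (by fun_prop) ((hU.comp continuous_swap).measurable.enorm.pow_const p)
  calc _ ≤ ∫⁻ x, (∫⁻ Y : V, ENNReal.ofReal (Real.exp (-π * ‖Y‖ ^ 2))) ^ (p - 1) *
        ∫⁻ Y : V, ENNReal.ofReal (Real.exp (-π * ‖Y‖ ^ 2)) * ‖U Y x‖ₑ ^ p :=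
        lintegral_mono fun x => lintegral_mul_rpow_le hp (by fun_prop)
          (hU1 x).measurable.enorm
    _ = _ := by
        rw [lintegral_const_mul _ hm.lintegral_prod_right',
          lintegral_lintegral_swap hm.aemeasurable]
        congr 1
        refine lintegral_congr fun Y => ?_
        simp only
        rw [lintegral_const_mul _ ((hU2 Y).measurable.enorm.pow_const p), ip]

lemma exists_tsum_lintegral_gavg_le {Λ e p : ℝ} (hΛ : 1 < Λ) (he : 0 < e) (hp : 1 ≤ p)
    {D : Rn1 n → 𝓢(Rn1 n, ℂ) →ₗ[ℂ] 𝓢(Rn1 n, ℂ)} (hD : ∀ v f g, cv (D v f) g = D v (cv f g))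
    (hDc : ∀ u, Continuous fun z : Rn1 n × Rn1 n => D z.1 u z.2) (hD0 : ∀ u, D 0 u = 0)
    {v : V → Rn1 n} (hv : Continuous v) (hv0 : v 0 = 0) (K : 𝓢(Rn1 n, ℂ)) :
    ∃ C : ℝ≥0, ∀ g : 𝓢(Rn1 n, ℂ),
      ∑' j : ℕ, ENNReal.ofReal ((Λ ^ (j + 1)) ^ e) * ∫⁻ x, gavg (fun Y : V =>
        ⇑(D (v ((Λ ^ (j + 1))⁻¹ • Y)) (cv (dil (2 ^ (j + 1)) (by positivity) K) g))) x ^ p ≤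
      C * ∫⁻ Y : V, ENNReal.ofReal (‖Y‖ ^ (-(Module.finrank ℝ V + e))) * pNorm p (D (v Y) g) ^ p := by
  obtain ⟨C, hC⟩ := exists_tsum_lintegral_gaussian_le (V := V) hΛ he
  have hp0 : 0 < p := by linarith
  set w : ℝ≥0∞ := (∫⁻ Y : V, ENNReal.ofReal (Real.exp (-π * ‖Y‖ ^ 2))) ^ (p - 1) with hw
  have hwt : w ≠ ⊤ := ENNReal.rpow_ne_top_of_nonneg (by linarith) lintegral_gaussian_lt_top.ne
  have hKt : lone K ^ p ≠ ⊤ := ENNReal.rpow_ne_top_of_nonneg hp0.le (lone_lt_top K).ne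
  refine ⟨(w * lone K ^ p).toNNReal * C, fun g => ?_⟩
  rw [ENNReal.coe_mul, ENNReal.coe_toNNReal (ENNReal.mul_ne_top hwt hKt), mul_assoc]
  have hF : Measurable fun Y : V => pNorm p (D (v Y) g) ^ p := by
    have h : Measurable fun z : V × Rn1 n => ‖D (v z.1) g z.2‖ₑ ^ p := by
      exact (continuous_uncurry_apply (D := fun v => D v) hDc hv g).measurable.enorm.pow_const p
    simp only [pNorm_rpow_eq_ip hp]
    exact h.lintegral_prod_right'
  have hF0 : pNorm p (D (v 0) g) ^ p = 0 := by
    rw [pNorm_rpow_eq_ip hp, hv0, hD0]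
    simp [ip, hp0]
  grw [← hC _ hF hF0, ← ENNReal.tsum_mul_left]
  refine ENNReal.tsum_le_tsum fun j => ?_
  rw [mul_left_comm]
  gcongr
  have hc : Continuous (Function.uncurry fun Y : V =>
      ⇑(D (v ((Λ ^ (j + 1))⁻¹ • Y)) (cv (dil (2 ^ (j + 1)) (by positivity) K) g))) :=
    continuous_uncurry_apply (D := fun v => D v) hDc (hv.comp (continuous_const_smul _)) _
  grw [lintegral_gavg_rpow_le hp hc, mul_assoc]
  gcongr
  have hm : Measurable fun Y : V => ENNReal.ofReal (Real.exp (-π * ‖Y‖ ^ 2)) *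
      pNorm p (D (v ((Λ ^ (j + 1))⁻¹ • Y)) g) ^ p :=
    .mul (by fun_prop) (hF.comp (measurable_const_smul _))
  rw [← lintegral_const_mul _ hm]
  refine lintegral_mono fun Y => ?_
  simp only
  rw [mul_left_comm, pNorm_rpow_eq_ip hp, cv_comm, ← hD, cv_comm]
  gcongr
  grw [ip_cv_le hp, lintegral_dil (by positivity)]
  rfl

end average

lemma dif_zero (u : 𝓢(Rn1 n, ℂ)) : dif 0 u = 0 := by
  ext x; simp [dif_apply]

lemma dif2_zero (u : 𝓢(Rn1 n, ℂ)) : dif2 0 u = 0 := by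
  ext x; simp [dif2_apply]; ring

/-- The sum of the difference integrals of the top order derivatives, where `s = α - 2i`. -/
def topDiff (i : ℕ) (s p : ℝ) (f : 𝓢(Rn1 n, ℂ)) : ℝ≥0∞ :=
  (∫⁻ h : ℝ, ENNReal.ofReal (|h| ^ (-(1 + p * s / 2))) * pNorm p (dif (0, h) (sD 0 i f)) ^ p) +
  ∑ k : Fin n, ∫⁻ Y : Rn n, ENNReal.ofReal (‖Y‖ ^ (-((n : ℝ) + p * s))) *
    pNorm p (dif2 (Y, 0) (sD (Pi.single k (2 * i)) 0 f)) ^ p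

/-- The Gaussian averages of the time differences at scale `2^{-(j+1)}`. -/
def gavgT (i : ℕ) (K f : 𝓢(Rn1 n, ℂ)) (j : ℕ) : Rn1 n → ℝ≥0∞ :=
  gavg fun h : ℝ => ⇑(dif ((0, ((4 : ℝ) ^ (j + 1))⁻¹ • h) : Rn1 n)
    (cv (dil (2 ^ (j + 1)) (by positivity) K) (sD 0 i f)))

/-- The Gaussian averages of the second space differences at scale `2^{-(j+1)}`. -/
def gavgX (i : ℕ) (K f : 𝓢(Rn1 n, ℂ)) (j : ℕ) (k : Fin n) : Rn1 n → ℝ≥0∞ :=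
  gavg fun Y : Rn n => ⇑(dif2 ((((2 : ℝ) ^ (j + 1))⁻¹ • Y, 0) : Rn1 n)
    (cv (dil (2 ^ (j + 1)) (by positivity) K) (sD (Pi.single k (2 * i)) 0 f)))

lemma measurable_gavgT (i : ℕ) (K f : 𝓢(Rn1 n, ℂ)) (j : ℕ) : Measurable (gavgT i K f j) :=
  measurable_gavg (continuous_uncurry_apply (D := fun v => dif v) continuous_dif_apply
    (v := fun h => ((0, ((4 : ℝ) ^ (j + 1))⁻¹ • h) : Rn1 n)) (by fun_prop) _)

lemma measurable_gavgX (i : ℕ) (K f : 𝓢(Rn1 n, ℂ)) (j : ℕ) (k : Fin n) :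
    Measurable (gavgX i K f j k) :=
  measurable_gavg (continuous_uncurry_apply (D := fun v => dif2 v) continuous_dif2_apply
    (v := fun Y => ((((2 : ℝ) ^ (j + 1))⁻¹ • Y, 0) : Rn1 n)) (by fun_prop) _)

lemma ParabolicLP.enorm_cv_blk_succ_rpow_le (P : ParabolicLP n) {i : ℕ} {p : ℝ} (hp : 1 ≤ p)
    {K : Option (Fin n) → 𝓢(Rn1 n, ℂ)} (hK : ∀ q, ∑ o, fs (K o) q * osym i o q = fs P.φ q)
    (f : 𝓢(Rn1 n, ℂ)) (j : ℕ) (x : Rn1 n) :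
    ‖cv (P.blk (j + 1)) f x‖ₑ ^ p ≤ ENNReal.ofReal ((2 ^ (j + 1)) ^ (-(2 * i * p))) *
      (2 ^ (p - 1) * (gavgT i (K none) f j x ^ p +
        (n : ℝ≥0∞) ^ (p - 1) * ∑ k, gavgX i (K (some k)) f j k x ^ p)) := by
  have hp0 : 0 ≤ p := by linarith
  rw [P.cv_blk_succ_apply hK, enorm_mul, ENNReal.mul_rpow_of_nonneg _ _ hp0]
  have h1 : ‖(((2 ^ (j + 1))⁻¹ : ℝ) : ℂ) ^ (2 * i)‖ₑ ^ p =
      ENNReal.ofReal ((2 ^ (j + 1)) ^ (-(2 * i * p))) := by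
    rw [← ofReal_norm, norm_pow, Complex.norm_real, Real.norm_of_nonneg (by positivity),
      ENNReal.ofReal_rpow_of_nonneg (by positivity) hp0, inv_pow, ← Real.rpow_natCast _ (2 * i),
      ← Real.rpow_neg (by positivity), ← Real.rpow_mul (by positivity)]
    congr 2
    push_cast
    ring
  rw [h1]
  gcongr
  calc _ ≤ (gavgT i (K none) f j x + ∑ k, gavgX i (K (some k)) f j k x) ^ p := by
        gcongr
        refine (enorm_add_le _ _).trans (add_le_add (enorm_integral_le_gavg _ _) ?_)
        exact (enorm_sum_le _ _).trans
          (Finset.sum_le_sum fun k _ => enorm_integral_le_gavg _ _)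
    _ ≤ _ := by
        grw [add_rpow_le hp, sum_rpow_le hp, Finset.card_univ, Fintype.card_fin]

lemma ParabolicLP.bx_succ_rpow_le (P : ParabolicLP n) {i : ℕ} {p : ℝ} (α : ℝ) (hp : 1 ≤ p)
    {K : Option (Fin n) → 𝓢(Rn1 n, ℂ)} (hK : ∀ q, ∑ o, fs (K o) q * osym i o q = fs P.φ q)
    (f : 𝓢(Rn1 n, ℂ)) (j : ℕ) :
    bx P α p f (j + 1) ^ p ≤ 2 ^ (p - 1) *
      (ENNReal.ofReal ((4 ^ (j + 1)) ^ (p * (α - 2 * i) / 2)) * ∫⁻ x, gavgT i (K none) f j x ^ p) +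
      2 ^ (p - 1) * ((n : ℝ≥0∞) ^ (p - 1) * ∑ k, ENNReal.ofReal ((2 ^ (j + 1)) ^ (p * (α - 2 * i))) *
        ∫⁻ x, gavgX i (K (some k)) f j k x ^ p) := by
  have hp0 : 0 ≤ p := by linarith
  have h4 : ((4 : ℝ) ^ (j + 1)) ^ (p * (α - 2 * i) / 2) = (2 ^ (j + 1)) ^ (p * (α - 2 * i)) := by
    rw [show (4 : ℝ) ^ (j + 1) = (2 ^ (j + 1)) ^ 2 by rw [← pow_mul, mul_comm, pow_mul]; norm_num,
      ← Real.rpow_natCast _ 2, ← Real.rpow_mul (by positivity)]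
    congr 1
    push_cast
    ring
  have hmT := (measurable_gavgT i (K none) f j).pow_const p
  have hmX := fun k => (measurable_gavgX i (K (some k)) f j k).pow_const p
  have hmX' : Measurable fun x => ∑ k, gavgX i (K (some k)) f j k x ^ p :=
    Finset.measurable_sum _ fun k _ => hmX k
  rw [bx, ENNReal.mul_rpow_of_nonneg _ _ hp0, pNorm_rpow_eq_ip hp, ip]
  grw [lintegral_mono (P.enorm_cv_blk_succ_rpow_le hp hK f j)]
  have hm : Measurable fun x => gavgT i (K none) f j x ^ p +
      (n : ℝ≥0∞) ^ (p - 1) * ∑ k, gavgX i (K (some k)) f j k x ^ p := hmT.add (hmX'.const_mul _)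
  rw [lintegral_const_mul _ (hm.const_mul _), lintegral_const_mul _ hm, lintegral_add_left hmT,
    lintegral_const_mul _ hmX', lintegral_finsetSum _ fun k _ => hmX k, ← mul_assoc (_ ^ p),
    ENNReal.ofReal_rpow_of_nonneg (by positivity) hp0, ← ENNReal.ofReal_mul (by positivity),
    ← Real.rpow_mul (by positivity), ← Real.rpow_add (by positivity), h4, ← Finset.mul_sum]
  rw [show α * p + -(2 * i * p) = p * (α - 2 * i) by ring]
  apply le_of_eq
  ring

theorem ParabolicLP.exists_tsum_bx_succ_le (P : ParabolicLP n) {i : ℕ} {p α : ℝ}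
    (hp : 1 ≤ p) (hα : 2 * i < α) :
    ∃ C : ℝ≥0, ∀ f, ∑' j, bx P α p f (j + 1) ^ p ≤ C * topDiff i (α - 2 * i) p f := by
  have hp0 : 0 < p := by linarith
  have hs : 0 < α - 2 * i := by linarith
  obtain ⟨K, hK⟩ := P.exists_sum_fs_mul_eq (osym i) (contDiff_osym i)
    fun q hq => exists_osym_ne_zero i hq
  obtain ⟨CT, hCT⟩ := exists_tsum_lintegral_gavg_le (V := ℝ) (Λ := 4) (e := p * (α - 2 * i) / 2)
    (by norm_num) (by positivity) hp cv_dif continuous_dif_apply dif_zero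
    (v := fun h => ((0, h) : Rn1 n)) (by fun_prop) rfl (K none)
  choose CX hCX using fun k => exists_tsum_lintegral_gavg_le (V := Rn n) (Λ := 2)
    (e := p * (α - 2 * i)) (by norm_num) (by positivity) hp cv_dif2 continuous_dif2_apply dif2_zero
    (v := fun Y => ((Y, 0) : Rn1 n)) (by fun_prop) rfl (K (some k))
  have hCT' : ∀ f, ∑' j : ℕ, ENNReal.ofReal ((4 ^ (j + 1)) ^ (p * (α - 2 * i) / 2)) *
      ∫⁻ x, gavgT i (K none) f j x ^ p ≤ CT * topDiff i (α - 2 * i) p f := by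
    intro f
    refine (hCT (sD 0 i f)).trans ?_
    gcongr
    refine le_trans (le_of_eq ?_) le_self_add
    simp
  have hCX' : ∀ k f, ∑' j : ℕ, ENNReal.ofReal ((2 ^ (j + 1)) ^ (p * (α - 2 * i))) *
      ∫⁻ x, gavgX i (K (some k)) f j k x ^ p ≤ CX k * topDiff i (α - 2 * i) p f := by
    intro k f
    refine (hCX k (sD (Pi.single k (2 * i)) 0 f)).trans ?_
    gcongr
    refine le_trans ?_ le_add_self
    refine le_trans (le_of_eq ?_) (Finset.single_le_sum (fun _ _ => zero_le) (Finset.mem_univ k))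
    simp
  have hNt : (n : ℝ≥0∞) ^ (p - 1) ≠ ⊤ := ENNReal.rpow_ne_top_of_nonneg (by linarith) (by simp)
  have hTt : (2 : ℝ≥0∞) ^ (p - 1) ≠ ⊤ := ENNReal.rpow_ne_top_of_nonneg (by linarith) (by simp)
  refine ⟨((2 : ℝ≥0∞) ^ (p - 1)).toNNReal *
    (CT + ((n : ℝ≥0∞) ^ (p - 1)).toNNReal * ∑ k, CX k), fun f => ?_⟩
  calc _ ≤ _ := ENNReal.tsum_le_tsum (P.bx_succ_rpow_le α hp hK f)
    _ ≤ 2 ^ (p - 1) * (CT * topDiff i (α - 2 * i) p f) + 2 ^ (p - 1) *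
        ((n : ℝ≥0∞) ^ (p - 1) * ∑ k, CX k * topDiff i (α - 2 * i) p f) := by
      rw [ENNReal.tsum_add, ENNReal.tsum_mul_left, ENNReal.tsum_mul_left, ENNReal.tsum_mul_left,
        Summable.tsum_finsetSum fun _ _ => ENNReal.summable]
      gcongr with k
      · exact hCT' f
      · exact hCX' k f
    _ = _ := by
      push_cast
      rw [ENNReal.coe_toNNReal hNt, ENNReal.coe_toNNReal hTt, ← Finset.sum_mul]
      ring

lemma pBesov_eq (P : ParabolicLP n) (α p : ℝ) (f : 𝓢(Rn1 n, ℂ)) :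
    pBesov P α p f = bx P α p f 0 + (∑' j, bx P α p f (j + 1) ^ p) ^ (1 / p) := by
  have h : ∀ j : ℕ, ((2 : ℝ) ^ (j + 1)) ^ α = 2 ^ (α * ((j : ℝ) + 1)) := fun j => by
    rw [← Real.rpow_natCast, ← Real.rpow_mul (by norm_num), mul_comm]
    push_cast
    rfl
  simp only [pBesov, bx, pNorm, coe_cv, P.coe_blk_succ, h]
  simp [ParabolicLP.blk]

lemma pBesov_rpow_le (P : ParabolicLP n) (α : ℝ) {p : ℝ} (hp : 1 ≤ p) (f : 𝓢(Rn1 n, ℂ)) :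
    pBesov P α p f ^ p ≤
      2 ^ (p - 1) * (bx P α p f 0 ^ p + ∑' j, bx P α p f (j + 1) ^ p) := by
  rw [pBesov_eq]
  refine (add_rpow_le hp _ _).trans (le_of_eq ?_)
  rw [← ENNReal.rpow_mul, one_div_mul_cancel (by positivity), ENNReal.rpow_one]

lemma tsum_bx_le (P : ParabolicLP n) (α : ℝ) {p : ℝ} (hp : 1 ≤ p) (f : 𝓢(Rn1 n, ℂ)) :
    ∑' j, bx P α p f j ^ p ≤ 2 * pBesov P α p f ^ p := by
  have hp0 : 0 < p := by linarith
  rw [tsum_eq_zero_add' ENNReal.summable, two_mul, pBesov_eq]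
  gcongr
  · exact le_self_add
  · refine le_trans (le_of_eq ?_) (ENNReal.rpow_le_rpow le_add_self hp0.le)
    rw [← ENNReal.rpow_mul, one_div_mul_cancel hp0.ne', ENNReal.rpow_one]

lemma dXmulti_eq_sD (β : Fin n → ℕ) (f : 𝓢(Rn1 n, ℂ)) : dXmulti β ⇑f = sD β 0 f := by
  rw [coe_sD, Function.iterate_zero, id]

lemma iterate_dT_eq_sD (l : ℕ) (f : 𝓢(Rn1 n, ℂ)) : dT^[l] ⇑f = sD 0 l f := by
  rw [coe_sD, dXmulti]
  induction List.finRange n with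
  | nil => rfl
  | cons k L ih => rw [List.foldr_cons, ← ih]; rfl

/-- The sum of the `p`-th powers of the `Lᵖ` norms of the derivatives of parabolic order at most
`2i`. -/
def sobSum (i : ℕ) (p : ℝ) (f : 𝓢(Rn1 n, ℂ)) : ℝ≥0∞ :=
  ∑ l ∈ Finset.range (i + 1),
    ∑ β ∈ (Fintype.piFinset fun _ : Fin n => Finset.range (2 * i + 1)).filter
        (fun β => (∑ k, β k) + 2 * l ≤ 2 * i),
      pNorm p (sD β l f) ^ p

/-- The seminorm of second differences in space of the spatial derivatives of order `2i`. -/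
def spaceSum (i : ℕ) (s p : ℝ) (f : 𝓢(Rn1 n, ℂ)) : ℝ≥0∞ :=
  ∑ β ∈ multiIdx n (2 * i),
    ∫⁻ Y : Rn n, ENNReal.ofReal (‖Y‖ ^ (-((n : ℝ) + p * s))) * pNorm p (dif2 (Y, 0) (sD β 0 f)) ^ p

/-- The seminorm of first differences in time of the time derivative of order `i`. -/
def timeInt (i : ℕ) (s p : ℝ) (f : 𝓢(Rn1 n, ℂ)) : ℝ≥0∞ :=
  ∫⁻ h : ℝ, ENNReal.ofReal (|h| ^ (-(1 + p * s / 2))) * pNorm p (dif (0, h) (sD 0 i f)) ^ p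

lemma single_mem_multiIdx (k : Fin n) (N : ℕ) : Pi.single k N ∈ multiIdx n N := by
  simp only [multiIdx, Finset.mem_filter, Fintype.mem_piFinset, Finset.mem_range]
  refine ⟨fun j => ?_, by simp⟩
  by_cases h : j = k
  · subst h; simp
  · simp [h]

lemma topDiff_le (i : ℕ) (s p : ℝ) (f : 𝓢(Rn1 n, ℂ)) :
    topDiff i s p f ≤ timeInt i s p f + n * spaceSum i s p f := by
  rw [topDiff, timeInt]
  gcongr
  refine (Finset.sum_le_card_nsmul _ _ (spaceSum i s p f) fun k _ => ?_).trans (by simp)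
  exact Finset.single_le_sum (f := fun β => ∫⁻ Y : Rn n, ENNReal.ofReal
    (‖Y‖ ^ (-((n : ℝ) + p * s))) * pNorm p (dif2 (Y, 0) (sD β 0 f)) ^ p)
    (fun _ _ => zero_le) (single_mem_multiIdx k (2 * i))

lemma bx_zero_le (P : ParabolicLP n) (i : ℕ) (α : ℝ) {p : ℝ} (hp : 1 ≤ p) (f : 𝓢(Rn1 n, ℂ)) :
    bx P α p f 0 ^ p ≤ lone P.ψ ^ p * sobSum i p f := by
  have h : bx P α p f 0 ≤ lone P.ψ * pNorm p f := by
    simpa [bx, ParabolicLP.blk, lone] using eLpNorm_cv_le hp P.ψ f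
  refine (ENNReal.rpow_le_rpow h (by linarith)).trans ?_
  rw [ENNReal.mul_rpow_of_nonneg _ _ (by linarith)]
  gcongr
  have h0 : pNorm p f ^ p = pNorm p (sD 0 0 f) ^ p := by
    rw [← iterate_dT_eq_sD, Function.iterate_zero, id]
  rw [h0, sobSum]
  refine le_trans ?_ (Finset.single_le_sum (fun _ _ => zero_le)
    (Finset.mem_range.2 i.succ_pos : 0 ∈ _))
  exact Finset.single_le_sum (f := fun β => pNorm p (sD β 0 f) ^ p) (fun _ _ => zero_le)
    (by simp : (0 : Fin n → ℕ) ∈ _)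

lemma ParabolicLP.exists_pBesov_rpow_le (P : ParabolicLP n) {i : ℕ} {p α : ℝ} (hp : 1 ≤ p)
    (hα : 2 * i < α) :
    ∃ C : ℝ≥0, ∀ f : 𝓢(Rn1 n, ℂ), pBesov P α p f ^ p ≤
      C * (sobSum i p f + timeInt i (α - 2 * i) p f + spaceSum i (α - 2 * i) p f) := by
  have hp0 : 0 < p := by linarith
  obtain ⟨C, hC⟩ := P.exists_tsum_bx_succ_le hp hα
  have hT : (2 : ℝ≥0∞) ^ (p - 1) ≠ ⊤ := ENNReal.rpow_ne_top_of_nonneg (by linarith) (by simp)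
  have hL : lone P.ψ ^ p ≠ ⊤ := ENNReal.rpow_ne_top_of_nonneg hp0.le (lone_lt_top _).ne
  refine ⟨((2 : ℝ≥0∞) ^ (p - 1)).toNNReal * ((lone P.ψ ^ p).toNNReal + C * (1 + n)), fun f => ?_⟩
  push_cast
  rw [ENNReal.coe_toNNReal hT, ENNReal.coe_toNNReal hL]
  set M := sobSum i p f + timeInt i (α - 2 * i) p f + spaceSum i (α - 2 * i) p f with hM
  have h1 : sobSum i p f ≤ M := by rw [hM, add_assoc]; exact le_self_add
  have h2 : timeInt i (α - 2 * i) p f ≤ M := le_add_self.trans le_self_add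
  have h3 : spaceSum i (α - 2 * i) p f ≤ M := le_add_self
  grw [pBesov_rpow_le P α hp f, bx_zero_le P i α hp f, hC f, topDiff_le, h1, h2, h3]
  apply le_of_eq
  ring

lemma exists_sum_le {ι F : Type*} (s : Finset ι) {a : ι → F → ℝ≥0∞} {b : F → ℝ≥0∞}
    (h : ∀ k ∈ s, ∃ C : ℝ≥0, ∀ f, a k f ≤ C * b f) :
    ∃ C : ℝ≥0, ∀ f, ∑ k ∈ s, a k f ≤ C * b f := by
  choose! C hC using h
  refine ⟨∑ k ∈ s, C k, fun f => ?_⟩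
  push_cast
  rw [Finset.sum_mul]
  exact Finset.sum_le_sum fun k hk => hC k hk f

lemma ParabolicLP.exists_le_pBesov_rpow (P : ParabolicLP n) (hn : 1 ≤ n) {i : ℕ} {p α : ℝ}
    (hp : 1 ≤ p) (hα1 : 2 * i < α) (hα2 : α < 2 * i + 2) :
    ∃ C : ℝ≥0, ∀ f : 𝓢(Rn1 n, ℂ),
      sobSum i p f + timeInt i (α - 2 * i) p f + spaceSum i (α - 2 * i) p f ≤
        C * pBesov P α p f ^ p := by
  have hs0 : 0 < α - 2 * i := by linarith
  have hs2 : α - 2 * i < 2 := by linarith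
  obtain ⟨C1, h1⟩ : ∃ C : ℝ≥0, ∀ f : 𝓢(Rn1 n, ℂ), sobSum i p f ≤ C * ∑' j, bx P α p f j ^ p := by
    refine exists_sum_le _ fun l _ => exists_sum_le _ fun β hβ => P.exists_pNorm_sD_le hp β l ?_
    have := (Finset.mem_filter.1 hβ).2
    have : (((∑ k, β k) + 2 * l : ℕ) : ℝ) ≤ (2 * i : ℕ) := by exact_mod_cast this
    push_cast at this ⊢
    linarith
  obtain ⟨C2, h2⟩ := P.exists_lintegral_dif_le (α := α) (s := α - 2 * i) hp 0 i (by simp) hs0 hs2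
  obtain ⟨C3, h3⟩ : ∃ C : ℝ≥0, ∀ f : 𝓢(Rn1 n, ℂ),
      spaceSum i (α - 2 * i) p f ≤ C * ∑' j, bx P α p f j ^ p := by
    refine exists_sum_le _ fun β hβ => P.exists_lintegral_dif2_le hn hp β 0 ?_ hs0 hs2
    rw [(Finset.mem_filter.1 hβ).2]
    simp
  refine ⟨2 * (C1 + C2 + C3), fun f => ?_⟩
  grw [h1 f, timeInt, h2 f, h3 f, tsum_bx_le P α hp f]
  push_cast
  apply le_of_eq
  ring

end

/-- For `2i < α < 2i+2`, the `p`-th power of the parabolic Besov norm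
`N_{α,p}` is equivalent to the `W^{2i,i}_p` norm power plus the second-difference seminorm
powers of the top-order derivatives. -/
theorem stmt11 (n : ℕ) (hn : 1 ≤ n) (p : ℝ) (hp : 1 ≤ p) (i : ℕ) (α : ℝ)
    (hα1 : 2 * (i : ℝ) < α) (hα2 : α < 2 * (i : ℝ) + 2) (P : ParabolicLP n) :
    ∃ c C : ℝ, 0 < c ∧ 0 < C ∧
      ∀ f : SchwartzMap (Rn1 n) ℂ,
        ENNReal.ofReal c * pBesov P α p ⇑f ^ p ≤
            (∑ l ∈ Finset.range (i + 1),
              ∑ β ∈ (Fintype.piFinset fun _ : Fin n => Finset.range (2 * i + 1)).filter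
                  (fun β => (∑ k, β k) + 2 * l ≤ 2 * i),
                pNorm p (dXmulti β (dT^[l] ⇑f)) ^ p)
            + (∫⁻ X : Rn n, ∫⁻ t : ℝ, ∫⁻ s : ℝ,
                ENNReal.ofReal (‖dT^[i] (⇑f) (X, t) - dT^[i] (⇑f) (X, s)‖ ^ p /
                  |t - s| ^ (1 + p * (α - 2 * i) / 2)))
            + ∑ β ∈ multiIdx n (2 * i),
                ∫⁻ t : ℝ, ∫⁻ X : Rn n, ∫⁻ Y : Rn n,
                  ENNReal.ofReal
                    (‖dXmulti β (⇑f) (X + Y, t) - 2 * dXmulti β (⇑f) (X, t) +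
                        dXmulti β (⇑f) (X - Y, t)‖ ^ p / ‖Y‖ ^ ((n : ℝ) + p * (α - 2 * i)))
          ∧
          (∑ l ∈ Finset.range (i + 1),
              ∑ β ∈ (Fintype.piFinset fun _ : Fin n => Finset.range (2 * i + 1)).filter
                  (fun β => (∑ k, β k) + 2 * l ≤ 2 * i),
                pNorm p (dXmulti β (dT^[l] ⇑f)) ^ p)
            + (∫⁻ X : Rn n, ∫⁻ t : ℝ, ∫⁻ s : ℝ,
                ENNReal.ofReal (‖dT^[i] (⇑f) (X, t) - dT^[i] (⇑f) (X, s)‖ ^ p /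
                  |t - s| ^ (1 + p * (α - 2 * i) / 2)))
            + ∑ β ∈ multiIdx n (2 * i),
                ∫⁻ t : ℝ, ∫⁻ X : Rn n, ∫⁻ Y : Rn n,
                  ENNReal.ofReal
                    (‖dXmulti β (⇑f) (X + Y, t) - 2 * dXmulti β (⇑f) (X, t) +
                        dXmulti β (⇑f) (X - Y, t)‖ ^ p / ‖Y‖ ^ ((n : ℝ) + p * (α - 2 * i)))
            ≤ ENNReal.ofReal C * pBesov P α p ⇑f ^ p := by
  obtain ⟨C₁, h₁⟩ := P.exists_pBesov_rpow_le hp hα1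
  obtain ⟨C₂, h₂⟩ := P.exists_le_pBesov_rpow hn hp hα1 hα2
  refine ⟨((C₁ : ℝ) + 1)⁻¹, C₂ + 1, by positivity, by positivity, fun f => ?_⟩
  simp only [← coe_sD]
  simp only [dXmulti_eq_sD, iterate_dT_eq_sD, lintegral_T_eq hp, lintegral_X_eq hp]
  change _ ≤ sobSum i p f + timeInt i (α - 2 * i) p f + spaceSum i (α - 2 * i) p f ∧
    sobSum i p f + timeInt i (α - 2 * i) p f + spaceSum i (α - 2 * i) p f ≤ _
  constructor
  · rw [ENNReal.ofReal_inv_of_pos (by positivity), ENNReal.ofReal_add (by positivity) zero_le_one,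
      ENNReal.ofReal_coe_nnreal, ENNReal.ofReal_one, mul_comm, ← div_eq_mul_inv]
    refine ENNReal.div_le_of_le_mul' ((h₁ f).trans ?_)
    gcongr
    exact le_self_add
  · refine (h₂ f).trans ?_
    rw [ENNReal.ofReal_add (by positivity) zero_le_one, ENNReal.ofReal_coe_nnreal]
    gcongr
    exact le_self_add
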